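/- arXiv:1210.0648 — 2 statements merged into one kernel-verified Lean document; each statement's English description precedes it below -/
import Mathlib

section
/- Let A be an n×n generalized Cartan matrix whose Weyl group W(A) is infinite and whose Coxeter graph is connected. Then deg P(A) ≥ 2 (i.e., the conjecture of Chapavalov, Leites and Stekolshchik that 0 ≤ deg P(A) ≤ 1 fails for A) if and only if K_0(A) = 0 and K_1(A) = 0. -/
open PowerSeries

/-- The Poincaré series of (the Coxeter group of) a Coxeter matrix: the generating
function of the number of elements of each length in its Coxeter group. -/
noncomputable def coxPoincare {B : Type*} (M : CoxeterMatrix B) : PowerSeries ℤ :=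
  PowerSeries.mk fun k =>
    (Nat.card {w : M.Group // M.toCoxeterSystem.length w = k} : ℤ)

/-- `A` is a generalized Cartan matrix. -/
structure IsGCM {n : ℕ} (A : Matrix (Fin n) (Fin n) ℤ) : Prop where
  diag : ∀ i, A i i = 2
  nonpos : ∀ i j, i ≠ j → A i j ≤ 0
  zero_symm : ∀ i j, A i j = 0 → A j i = 0

/-- The Coxeter matrix entry associated to the product `aᵢⱼ·aⱼᵢ`:
it is `2, 3, 4, 6, ∞` according as the product is `0, 1, 2, 3, ≥ 4`
(`0` encodes `∞`, as in Mathlib's convention for `CoxeterMatrix`). -/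
def gcmEntry (p : ℤ) : ℕ :=
  if p = 0 then 2 else if p = 1 then 3 else if p = 2 then 4 else if p = 3 then 6 else 0

/-- The Coxeter matrix of a generalized Cartan matrix. -/
def gcmCoxeter {n : ℕ} (A : Matrix (Fin n) (Fin n) ℤ) : CoxeterMatrix (Fin n) where
  M := Matrix.of fun i j => if i = j then 1 else gcmEntry (A i j * A j i)
  isSymm := by
    ext i j
    simp only [Matrix.transpose_apply, Matrix.of_apply]
    rcases eq_or_ne i j with h | h
    · simp [h]
    · rw [if_neg h.symm, if_neg h, mul_comm]
  diagonal i := by simp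
  off_diagonal i j h := by
    rw [Matrix.of_apply, if_neg h]
    unfold gcmEntry
    split_ifs <;> omega

/-- The Poincaré series of a Coxeter matrix, with rational coefficients. -/
noncomputable def coxPoincareQ {B : Type*} (M : CoxeterMatrix B) : PowerSeries ℚ :=
  PowerSeries.mk fun k =>
    (Nat.card {w : M.Group // M.toCoxeterSystem.length w = k} : ℚ)

/-- The Coxeter graph of a Coxeter matrix: vertices are joined iff the corresponding
entry is at least `3` (with `∞` encoded as `0`). -/
def coxeterGraph {B : Type*} (M : CoxeterMatrix B) : SimpleGraph B :=
  SimpleGraph.fromRel fun i j => M i j = 0 ∨ 3 ≤ M i j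

open scoped Classical

/-- The standard parabolic subgroup `W_I` of the Coxeter group of `M` generated by the
simple reflections indexed by `I`. -/
def coxParabolic {n : ℕ} (M : CoxeterMatrix (Fin n)) (I : Finset (Fin n)) :
    Subgroup M.Group :=
  Subgroup.closure (M.toCoxeterSystem.simple '' I)

/-- The power series `t^{D_I}`, where `D_I` is the maximal length of an element of the
standard parabolic subgroup `W_I` when `W_I` is finite; when `W_I` is infinite the
expression is interpreted as `0`. -/
noncomputable def tD {n : ℕ} (M : CoxeterMatrix (Fin n)) (I : Finset (Fin n)) :
    PowerSeries ℚ :=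
  if Finite (coxParabolic M I) then
    (PowerSeries.X : PowerSeries ℚ) ^
      (⨆ w : coxParabolic M I, M.toCoxeterSystem.length (w : M.Group))
  else 0

/-- `c` encodes a chain `S = I₀ ⊋ I₁ ⊋ ⋯ ⊋ I_r ⊋ ∅` of subsets of `S = {1, …, n}`. -/
def IsGCMChain {n r : ℕ} (c : Fin (r + 1) → Finset (Fin n)) : Prop :=
  c 0 = Finset.univ ∧ StrictAnti c ∧ c (Fin.last r) ≠ ∅

/-- The contribution `H_T` of a chain `T` (encoded by `c`):
`H_T = (∏_{j=1}^{r} (−1)^{|I_j|}·(t^{D_{I_{j−1}}} + (−1)^{|I_{j−1}|+1})⁻¹)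
  · (t^{D_{I_r}} + (−1)^{|I_r|+1})⁻¹`. -/
noncomputable def chainTerm {n r : ℕ} (M : CoxeterMatrix (Fin n))
    (c : Fin (r + 1) → Finset (Fin n)) : PowerSeries ℚ :=
  (∏ j : Fin r, ((-1 : PowerSeries ℚ) ^ (c j.succ).card *
      (tD M (c j.castSucc) + (-1 : PowerSeries ℚ) ^ ((c j.castSucc).card + 1))⁻¹)) *
    (tD M (c (Fin.last r)) + (-1 : PowerSeries ℚ) ^ ((c (Fin.last r)).card + 1))⁻¹

/-- `K₀(A)`: the sum of `(−1)^{n+r+1}` over all infinite chains (chains all of whose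
members have infinite parabolic subgroup). -/
noncomputable def K0 {n : ℕ} (M : CoxeterMatrix (Fin n)) : ℤ :=
  ∑ r ∈ Finset.range n, ∑ c : Fin (r + 1) → Finset (Fin n),
    if IsGCMChain c ∧ ∀ j, Infinite (coxParabolic M (c j)) then
      (-1 : ℤ) ^ (n + r + 1) else 0

/-- `K₁(A)`: the sum of `(−1)^{n+r+1}` over all quasi-infinite chains (chains
`I₀ ⊋ ⋯ ⊋ I_r` with `W_{I_j}` infinite for `j ≤ r − 1` and `|I_r| = 1`). -/
noncomputable def K1 {n : ℕ} (M : CoxeterMatrix (Fin n)) : ℤ :=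
  ∑ r ∈ Finset.range n, ∑ c : Fin (r + 1) → Finset (Fin n),
    if IsGCMChain c ∧ (∀ j : Fin r, Infinite (coxParabolic M (c j.castSucc))) ∧
        (c (Fin.last r)).card = 1 then
      (-1 : ℤ) ^ (n + r + 1) else 0

section CoxPart
variable {B : Type*} {W : Type*} [Group W] {M : CoxeterMatrix B} (cs : CoxeterSystem M W)

/-- sign permutation -/
noncomputable def etaGen (i : B) : Function.End (W × ZMod 2) :=
  fun p => (cs.simple i * p.1 * cs.simple i, p.2 + if p.1 = cs.simple i then 1 else 0)

lemma etaGen_pow (i j : B) (k : ℕ) (t : W) (e : ZMod 2) :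
    ((etaGen cs i * etaGen cs j) ^ k : Function.End (W × ZMod 2)) (t, e) =
      ((cs.simple i * cs.simple j) ^ k * t * ((cs.simple i * cs.simple j) ^ k)⁻¹,
        e + ∑ l ∈ Finset.range (2 * k),
          if t = cs.simple j * (cs.simple i * cs.simple j) ^ l then 1 else 0) := by
  set r := cs.simple i * cs.simple j with hr
  have hri : r⁻¹ = cs.simple j * cs.simple i := by simp [hr]
  have hconj : ∀ k : ℕ, (r ^ k)⁻¹ * cs.simple j = cs.simple j * r ^ k := by
    intro k
    have h1 : cs.simple j * r * (cs.simple j)⁻¹ = r⁻¹ := by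
      rw [hri, hr]; simp [mul_assoc]
    have h2 : cs.simple j * r ^ k * (cs.simple j)⁻¹ = (r⁻¹) ^ k := by
      rw [← h1, conj_pow]
    rw [← inv_pow, ← h2]; simp
  induction k generalizing t e with
  | zero => simp; rfl
  | succ k ih =>
    rw [pow_succ']
    have e1 : ∀ f g : Function.End (W × ZMod 2), ∀ x, (f * g) x = f (g x) := fun _ _ _ => rfl
    rw [e1, ih, e1]
    unfold etaGen
    have A : (r ^ k * t * (r ^ k)⁻¹ = cs.simple j) = (t = cs.simple j * r ^ (2 * k)) := by
      rw [two_mul, pow_add, ← mul_assoc, ← hconj, mul_inv_eq_iff_eq_mul,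
        mul_assoc _ _ (r ^ k), eq_inv_mul_iff_mul_eq]
    have C : (cs.simple j * (r ^ k * t * (r ^ k)⁻¹) * cs.simple j = cs.simple i) =
        (t = cs.simple j * r ^ (2 * k + 1)) := by
      have : cs.simple j * r ^ (2 * k + 1) = (r ^ k)⁻¹ * (cs.simple j * r) * r ^ k := by
        rw [← mul_assoc, hconj]
        rw [mul_assoc, mul_assoc, ← pow_succ', ← pow_add]; congr 2; ring
      rw [this]
      apply propext
      constructor
      · intro h
        have h' : r ^ k * t * (r ^ k)⁻¹ = cs.simple j * cs.simple i * cs.simple j := by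
          rw [← h]; simp [mul_assoc]
        have : t = (r ^ k)⁻¹ * (r ^ k * t * (r ^ k)⁻¹) * r ^ k := by group
        rw [this, h']; nth_rw 4 [hr]; simp only [mul_assoc]
      · intro h
        rw [h]; simp [hr, mul_assoc]
    have e2 : 2 * (k + 1) = 2 * k + 1 + 1 := by ring
    rw [e2, Finset.sum_range_succ, Finset.sum_range_succ]
    refine Prod.ext ?_ ?_
    · simp only [pow_succ', mul_inv_rev, hri]
      simp only [hr, mul_assoc]
    · simp only [A, C]; ring

lemma etaGen_liftable : M.IsLiftable (etaGen cs) := by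
  intro i j
  funext p
  obtain ⟨t, e⟩ := p
  rw [etaGen_pow]
  have h := cs.simple_mul_simple_pow i j
  rw [h]
  have : ∀ l, (cs.simple i * cs.simple j) ^ (M i j + l) = (cs.simple i * cs.simple j) ^ l := by
    intro l; rw [pow_add, h, one_mul]
  rw [two_mul, Finset.sum_range_add]
  simp only [this]
  rw [CharTwo.add_self_eq_zero]
  simp; rfl

/-- eta -/
noncomputable def eta (w t : W) : ZMod 2 := (cs.lift ⟨etaGen cs, etaGen_liftable cs⟩ w (t, 0)).2

lemma eta_lift (ω : List B) (t : W) (e : ZMod 2) :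
    cs.lift ⟨etaGen cs, etaGen_liftable cs⟩ (cs.wordProd ω) (t, e) =
      (cs.wordProd ω * t * (cs.wordProd ω)⁻¹, e + (cs.rightInvSeq ω).count t) := by
  induction ω with
  | nil => simp; rfl
  | cons i ω ih =>
    rw [cs.wordProd_cons, map_mul]
    have e1 : ∀ f g : Function.End (W × ZMod 2), ∀ x, (f * g) x = f (g x) := fun _ _ _ => rfl
    rw [e1, ih, cs.lift_apply_simple]
    unfold etaGen
    rw [CoxeterSystem.rightInvSeq, List.count_cons]
    refine Prod.ext ?_ ?_
    · simp [mul_assoc]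
    · have : (cs.wordProd ω * t * (cs.wordProd ω)⁻¹ = cs.simple i) =
        (((cs.wordProd ω)⁻¹ * cs.simple i * cs.wordProd ω == t) = true) := by
        simp only [beq_iff_eq, eq_iff_iff]
        constructor
        · intro h; rw [← h]; group
        · intro h; rw [← h]; group
      simp only [this]
      push_cast
      split_ifs <;> ring

lemma eta_word (ω : List B) (t : W) : eta cs (cs.wordProd ω) t = (cs.rightInvSeq ω).count t := by
  rw [eta, eta_lift]; simp

lemma eta_mul (x y t : W) : eta cs (x * y) t = eta cs y t + eta cs x (y * t * y⁻¹) := by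
  obtain ⟨ω, rfl⟩ := cs.wordProd_surjective x
  obtain ⟨ω', rfl⟩ := cs.wordProd_surjective y
  rw [eta_word, eta_word, eta, map_mul]
  have e1 : ∀ f g : Function.End (W × ZMod 2), ∀ x, (f * g) x = f (g x) := fun _ _ _ => rfl
  rw [e1, eta_lift, eta_lift]; simp

lemma eta_nodup (ω : List B) (h : (cs.rightInvSeq ω).Nodup) (t : W) :
    eta cs (cs.wordProd ω) t = 1 ↔ t ∈ cs.rightInvSeq ω := by
  rw [eta_word]
  by_cases ht : t ∈ cs.rightInvSeq ω
  · simp [ht, List.count_eq_one_of_mem h ht]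
  · simp [ht, List.count_eq_zero_of_not_mem ht]

lemma eta_card (w : W) : Set.ncard {t | eta cs w t = 1} = cs.length w := by
  obtain ⟨ω, hω, rfl⟩ := cs.exists_isReduced w
  have h := hω.nodup_rightInvSeq
  have : {t | eta cs (cs.wordProd ω) t = 1} = ((cs.rightInvSeq ω).toFinset : Set W) := by
    ext t; simp [eta_nodup cs ω h]
  rw [this, Set.ncard_coe_finset, List.toFinset_card_of_nodup h, hω.eq]; simp

lemma eta_finite (w : W) : Set.Finite {t | eta cs w t = 1} := by
  obtain ⟨ω, hω, rfl⟩ := cs.exists_isReduced w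
  have h := hω.nodup_rightInvSeq
  have : {t | eta cs (cs.wordProd ω) t = 1} = ((cs.rightInvSeq ω).toFinset : Set W) := by
    ext t; simp [eta_nodup cs ω h]
  rw [this]; exact Finset.finite_toSet _

lemma eta_lt (w t : W) (h : eta cs w t = 1) : cs.length (w * t) < cs.length w := by
  obtain ⟨ω, hω, rfl⟩ := cs.exists_isReduced w
  rw [eta_nodup cs ω hω.nodup_rightInvSeq] at h
  exact (cs.isRightInversion_of_mem_rightInvSeq hω h).2

lemma zmod2_cases (a : ZMod 2) : a = 0 ∨ a = 1 := by revert a; decide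

lemma eta_simple (w : W) (i : B) : eta cs w (cs.simple i) = 1 ↔ cs.IsRightDescent w i := by
  constructor
  · exact eta_lt cs w _
  · intro h
    rcases zmod2_cases (eta cs w (cs.simple i)) with h0 | h0
    · exfalso
      have := eta_mul cs w (cs.simple i) (cs.simple i)
      have h1 : eta cs (cs.simple i) (cs.simple i) = 1 := by
        have := eta_word cs [i] (cs.simple i)
        simpa using this
      rw [h1] at this
      simp [h0] at this
      have := eta_lt cs _ _ this
      simp at this
      exact absurd h (by unfold CoxeterSystem.IsRightDescent; omega)
    · exact h0

/-- J-words -/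
def par (J : Set B) : Subgroup W := Subgroup.closure (cs.simple '' J)

lemma par_word {J : Set B} (ω : List B) (h : ∀ i ∈ ω, i ∈ J) : cs.wordProd ω ∈ par cs J := by
  induction ω with
  | nil => simp [one_mem]
  | cons i ω ih =>
    rw [cs.wordProd_cons]
    exact mul_mem (Subgroup.subset_closure ⟨i, h i (by simp), rfl⟩) (ih fun j hj => h j (by simp [hj]))

lemma par_exists_word {J : Set B} {u : W} (hu : u ∈ par cs J) :
    ∃ ω : List B, (∀ i ∈ ω, i ∈ J) ∧ u = cs.wordProd ω := by
  induction hu using Subgroup.closure_induction with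
  | mem x hx => obtain ⟨i, hi, rfl⟩ := hx; exact ⟨[i], by simpa using hi, by simp⟩
  | one => exact ⟨[], by simp, by simp⟩
  | mul x y _ _ hx hy =>
    obtain ⟨a, ha, rfl⟩ := hx
    obtain ⟨b, hb, rfl⟩ := hy
    refine ⟨a ++ b, ?_, by rw [cs.wordProd_append]⟩
    intro i hi
    rcases List.mem_append.1 hi with h | h
    exacts [ha i h, hb i h]
  | inv x _ hx =>
    obtain ⟨a, ha, rfl⟩ := hx
    exact ⟨a.reverse, by simpa using ha, by simp⟩

lemma ris_mem_par {J : Set B} (ω : List B) (h : ∀ i ∈ ω, i ∈ J) :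
    ∀ t ∈ cs.rightInvSeq ω, t ∈ par cs J := by
  induction ω with
  | nil => simp
  | cons i ω ih =>
    intro t ht
    have hω : cs.wordProd ω ∈ par cs J := par_word cs ω fun j hj => h j (by simp [hj])
    rw [CoxeterSystem.rightInvSeq, List.mem_cons] at ht
    rcases ht with rfl | ht
    · exact mul_mem (mul_mem (inv_mem hω) (Subgroup.subset_closure ⟨i, h i (by simp), rfl⟩)) hω
    · exact ih (fun j hj => h j (by simp [hj])) t ht

lemma eta_mem_par {J : Set B} {u : W} (hu : u ∈ par cs J) {t : W} (h : eta cs u t = 1) :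
    t ∈ par cs J := by
  obtain ⟨ω, hω, rfl⟩ := par_exists_word cs hu
  refine ris_mem_par cs ω hω t ?_
  by_contra hn
  rw [eta_word, List.count_eq_zero_of_not_mem hn] at h
  simp at h

lemma exists_erase_two (ω : List B) (h : ¬ (cs.rightInvSeq ω).Nodup) :
    ∃ ω' : List B, ω'.length < ω.length ∧ (∀ i ∈ ω', i ∈ ω) ∧ cs.wordProd ω' = cs.wordProd ω := by
  induction ω with
  | nil => simp at h
  | cons i ω ih =>
    rw [CoxeterSystem.rightInvSeq, List.nodup_cons, not_and_or, not_not] at h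
    rcases h with h | h
    · obtain ⟨j, hj, he⟩ := List.mem_iff_getElem.mp h
      have := cs.wordProd_mul_getD_rightInvSeq ω j
      rw [List.getD_eq_getElem _ 1 hj, he] at this
      refine ⟨ω.eraseIdx j, ?_, ?_, ?_⟩
      · have := List.length_eraseIdx_le ω j
        simp; omega
      · intro k hk; exact List.mem_cons_of_mem _ (List.mem_of_mem_eraseIdx hk)
      · rw [← this, cs.wordProd_cons]; simp [← mul_assoc]
    · obtain ⟨ω', h1, h2, h3⟩ := ih h
      refine ⟨i :: ω', by simpa using h1, ?_, by rw [cs.wordProd_cons, cs.wordProd_cons, h3]⟩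
      intro k hk
      rcases List.mem_cons.1 hk with rfl | hk
      · simp
      · exact List.mem_cons_of_mem _ (h2 k hk)

lemma par_reduced {J : Set B} {u : W} (hu : u ∈ par cs J) :
    ∃ ω : List B, (∀ i ∈ ω, i ∈ J) ∧ cs.IsReduced ω ∧ u = cs.wordProd ω := by
  have hex : ∃ m, ∃ ω : List B, ω.length = m ∧ (∀ i ∈ ω, i ∈ J) ∧ u = cs.wordProd ω := by
    obtain ⟨ω, h⟩ := par_exists_word cs hu
    exact ⟨_, ω, rfl, h⟩
  obtain ⟨ω, h1, h2, h3⟩ := Nat.find_spec hex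
  refine ⟨ω, h2, ?_, h3⟩
  have hnd : (cs.rightInvSeq ω).Nodup := by
    by_contra hn
    obtain ⟨ω', a, b, c⟩ := exists_erase_two cs ω hn
    have := Nat.find_min' hex ⟨ω', rfl, fun i hi => h2 i (b i hi), by rw [h3, c]⟩
    omega
  have : {t | eta cs (cs.wordProd ω) t = 1} = ((cs.rightInvSeq ω).toFinset : Set W) := by
    ext t; simp [eta_nodup cs ω hnd]
  unfold CoxeterSystem.IsReduced
  rw [← eta_card, this, Set.ncard_coe_finset, List.toFinset_card_of_nodup hnd]; simp

lemma par_descent {J : Set B} {u : W} (hu : u ∈ par cs J) (h1 : u ≠ 1) :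
    ∃ i ∈ J, cs.IsRightDescent u i ∧ u * cs.simple i ∈ par cs J := by
  obtain ⟨ω, a, b, rfl⟩ := par_reduced cs hu
  rcases List.eq_nil_or_concat ω with rfl | ⟨ω', i, rfl⟩
  · simp at h1
  · have hi : i ∈ J := a i (by simp)
    refine ⟨i, hi, ?_, mul_mem hu (Subgroup.subset_closure ⟨i, hi, rfl⟩)⟩
    unfold CoxeterSystem.IsRightDescent
    rw [b.eq]
    rw [cs.wordProd_concat]
    have := cs.length_wordProd_le ω'
    simp; omega

lemma len_add_of_disj (x u : W) (h : ∀ t, eta cs u t = 1 → eta cs x (u * t * u⁻¹) = 0) :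
    cs.length (x * u) = cs.length x + cs.length u := by
  rw [← eta_card cs (x * u), ← eta_card cs x, ← eta_card cs u]
  have hinj : Function.Injective (fun t : W => u⁻¹ * t * u) := by
    intro a b hab; simpa using hab
  have e : {t | eta cs (x * u) t = 1} =
      ((fun t : W => u⁻¹ * t * u) '' {t | eta cs x t = 1}) ∪ {t | eta cs u t = 1} := by
    ext t
    simp only [Set.mem_ofPred_eq, Set.mem_union, Set.mem_image]
    rw [eta_mul]
    have : (∃ y, eta cs x y = 1 ∧ u⁻¹ * y * u = t) ↔ eta cs x (u * t * u⁻¹) = 1 := by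
      constructor
      · rintro ⟨y, hy, rfl⟩; simpa [mul_assoc] using hy
      · intro hy; exact ⟨_, hy, by simp [mul_assoc]⟩
    rw [this]
    rcases zmod2_cases (eta cs u t) with h0 | h0
    · simp [h0]
    · simp [h0, h t h0]
  rw [e, Set.ncard_union_eq ?_ ((eta_finite cs x).image _) (eta_finite cs u),
    Set.ncard_image_of_injective _ hinj]
  rw [Set.disjoint_left]
  rintro _ ⟨y, hy, rfl⟩ hu
  have := h _ hu
  simp only [Set.mem_ofPred_eq] at hy
  simp [mul_assoc, hy] at this

lemma exists_min_rep (J : Set B) (w : W) :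
    ∃ x u, u ∈ par cs J ∧ w = x * u ∧
      ∀ v ∈ par cs J, cs.length (x * v) = cs.length x + cs.length v := by
  have hex : ∃ m, ∃ u ∈ par cs J, cs.length (w * u) = m := ⟨_, 1, one_mem _, rfl⟩
  obtain ⟨u, hu, hl⟩ := Nat.find_spec hex
  refine ⟨w * u, u⁻¹, inv_mem hu, by simp, ?_⟩
  intro v hv
  apply len_add_of_disj
  intro t ht
  rcases zmod2_cases (eta cs (w * u) (v * t * v⁻¹)) with h0 | h0
  · exact h0
  · exfalso
    have h1 := eta_lt cs _ _ h0
    have := Nat.find_min' hex ⟨u * (v * t * v⁻¹), mul_mem hu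
      (mul_mem (mul_mem hv (eta_mem_par cs hv ht)) (inv_mem hv)), rfl⟩
    rw [← mul_assoc] at this
    omega

lemma len_add_of_noDescent {J : Set B} {x : W} (hx : ∀ i ∈ J, ¬ cs.IsRightDescent x i)
    {v : W} (hv : v ∈ par cs J) : cs.length (x * v) = cs.length x + cs.length v := by
  obtain ⟨y, u, hu, rfl, h⟩ := exists_min_rep cs J x
  by_cases h1 : u = 1
  · subst h1; simpa using h v hv
  · exfalso
    obtain ⟨i, hi, hd, hm⟩ := par_descent cs hu h1
    apply hx i hi
    unfold CoxeterSystem.IsRightDescent at *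
    rw [mul_assoc, h _ hm, h _ hu]; omega

lemma exists_decomp (J : Set B) (w : W) :
    ∃ x u, u ∈ par cs J ∧ w = x * u ∧ ∀ i ∈ J, ¬ cs.IsRightDescent x i := by
  obtain ⟨x, u, hu, rfl, h⟩ := exists_min_rep cs J w
  refine ⟨x, u, hu, rfl, fun i hi => ?_⟩
  unfold CoxeterSystem.IsRightDescent
  rw [h _ (Subgroup.subset_closure ⟨i, hi, rfl⟩)]; omega

lemma decomp_unique {J : Set B} {x x' u u' : W} (hx : ∀ i ∈ J, ¬ cs.IsRightDescent x i)
    (hx' : ∀ i ∈ J, ¬ cs.IsRightDescent x' i) (hu : u ∈ par cs J) (hu' : u' ∈ par cs J)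
    (h : x * u = x' * u') : x = x' ∧ u = u' := by
  have e : x' = x * (u * u'⁻¹) := by rw [← mul_assoc, h]; simp
  have e' : x = x' * (u' * u⁻¹) := by rw [← mul_assoc, ← h]; simp
  have l := len_add_of_noDescent cs hx (mul_mem hu (inv_mem hu'))
  have l' := len_add_of_noDescent cs hx' (mul_mem hu' (inv_mem hu))
  rw [← e] at l
  rw [← e'] at l'
  have : cs.length (u * u'⁻¹) = 0 := by omega
  rw [cs.length_eq_zero_iff] at this
  have hh := mul_inv_eq_one.1 this
  subst hh
  exact ⟨by simpa using h, rfl⟩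

lemma longest_sub {I : Set B} {w : W} (hw : ∀ i ∈ I, cs.IsRightDescent w i)
    {u : W} (hu : u ∈ par cs I) : cs.length (w * u⁻¹) + cs.length u = cs.length w := by
  induction hm : cs.length u generalizing u with
  | zero => rw [cs.length_eq_zero_iff] at hm; subst hm; simp
  | succ m ih =>
    have h1 : u ≠ 1 := by rintro rfl; simp at hm
    obtain ⟨i, hi, hd, hp⟩ := par_descent cs hu h1
    have hl : cs.length (u * cs.simple i) = m := by
      have := (cs.isRightDescent_iff).1 hd; omega
    have key := ih hp hl
    set u' := u * cs.simple i with hu'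
    have huu : u = u' * cs.simple i := by simp [hu']
    have a := (eta_simple cs w i).2 (hw i hi)
    have b : w = (w * u'⁻¹) * u' := by simp
    rw [b, eta_mul] at a
    have c : eta cs u' (cs.simple i) = 0 := by
      rcases zmod2_cases (eta cs u' (cs.simple i)) with h0 | h0
      · exact h0
      · have := eta_lt cs _ _ h0
        rw [← huu] at this; omega
    rw [c, zero_add] at a
    have d := eta_lt cs _ _ a
    have e : w * u'⁻¹ * (u' * cs.simple i * u'⁻¹) = w * u⁻¹ := by
      rw [huu]; simp [mul_assoc]
    rw [e] at d
    have := cs.length_mul_le (w * u⁻¹) u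
    simp at this
    omega
end CoxPart

section GF
variable {B : Type*} [Fintype B] {W : Type*} [Group W] {M : CoxeterMatrix B}
  (cs : CoxeterSystem M W)

lemma level_finite (k : ℕ) : Set.Finite {w : W | cs.length w = k} := by
  refine ((List.finite_length_eq B k).image cs.wordProd).subset ?_
  intro w hw
  obtain ⟨ω, h, rfl⟩ := cs.exists_isReduced w
  exact ⟨ω, by rw [← hw, Set.mem_ofPred_eq, h.eq], rfl⟩

/-- level set -/
noncomputable def lev (k : ℕ) : Finset W := (level_finite cs k).toFinset

lemma mem_lev {k : ℕ} {w : W} : w ∈ lev cs k ↔ cs.length w = k := by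
  simp [lev]

/-- generating series -/
noncomputable def gs (p : W → Prop) : PowerSeries ℚ :=
  PowerSeries.mk fun k => (((lev cs k).filter p).card : ℚ)

lemma gs_congr {p q : W → Prop} (h : ∀ w, p w ↔ q w) : gs cs p = gs cs q := by
  have : p = q := by funext w; exact propext (h w)
  rw [this]

lemma gs_mul {I J : Finset B} (hJ : J ⊆ I) :
    gs cs (fun w => w ∈ par cs (I : Set B)) =
      gs cs (fun w => w ∈ par cs (I : Set B) ∧ ∀ i ∈ J, ¬ cs.IsRightDescent w i) *
        gs cs (fun w => w ∈ par cs (J : Set B)) := by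
  ext k
  rw [PowerSeries.coeff_mul]
  simp only [gs, PowerSeries.coeff_mk]
  have hsub : par cs (J : Set B) ≤ par cs (I : Set B) :=
    Subgroup.closure_mono (Set.image_mono (by exact_mod_cast hJ))
  rw [← Finset.card_bij (s := (Finset.HasAntidiagonal.antidiagonal k).sigma fun p =>
      ((lev cs p.1).filter (fun w => w ∈ par cs (I : Set B) ∧ ∀ i ∈ J, ¬ cs.IsRightDescent w i)) ×ˢ
        ((lev cs p.2).filter (fun w => w ∈ par cs (J : Set B)))) (fun a _ => a.2.1 * a.2.2)]
  · rw [Finset.card_sigma]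
    push_cast
    refine Finset.sum_congr rfl fun p _ => ?_
    rw [Finset.card_product]; push_cast; congr!
  · rintro ⟨⟨a, b⟩, ⟨x, u⟩⟩ h
    simp only [Finset.mem_sigma, Finset.HasAntidiagonal.mem_antidiagonal, Finset.mem_product, Finset.mem_filter,
      mem_lev] at h ⊢
    obtain ⟨hk, ⟨hx, hxI, hxJ⟩, hu, huJ⟩ := h
    refine ⟨?_, mul_mem hxI (hsub huJ)⟩
    rw [len_add_of_noDescent cs (J := (J : Set B)) (by exact_mod_cast hxJ) huJ]; omega
  · rintro ⟨⟨a, b⟩, ⟨x, u⟩⟩ h ⟨⟨a', b'⟩, ⟨x', u'⟩⟩ h' e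
    simp only [Finset.mem_sigma, Finset.HasAntidiagonal.mem_antidiagonal, Finset.mem_product, Finset.mem_filter,
      mem_lev] at h h' e
    obtain ⟨hk, ⟨hx, hxI, hxJ⟩, hu, huJ⟩ := h
    obtain ⟨hk', ⟨hx', hxI', hxJ'⟩, hu', huJ'⟩ := h'
    obtain ⟨rfl, rfl⟩ := decomp_unique cs (J := (J : Set B)) (by exact_mod_cast hxJ)
      (by exact_mod_cast hxJ') huJ huJ' e
    subst hx hx' hu hu'
    rfl
  · intro w hw
    simp only [Finset.mem_filter, mem_lev] at hw
    obtain ⟨x, u, hu, rfl, hx⟩ := exists_decomp cs (J : Set B) w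
    refine ⟨⟨(cs.length x, cs.length u), (x, u)⟩, ?_, rfl⟩
    simp only [Finset.mem_sigma, Finset.HasAntidiagonal.mem_antidiagonal, Finset.mem_product, Finset.mem_filter,
      mem_lev]
    refine ⟨?_, ⟨trivial, ?_, by exact_mod_cast hx⟩, trivial, hu⟩
    · rw [← len_add_of_noDescent cs hx hu]; exact hw.1
    · have := mul_mem hw.2 (inv_mem (hsub hu)); simpa using this

lemma gs_alt (I : Finset B) :
    ∑ J ∈ I.powerset, (-1 : PowerSeries ℚ) ^ J.card *
      gs cs (fun w => w ∈ par cs (I : Set B) ∧ ∀ i ∈ J, ¬ cs.IsRightDescent w i) =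
    gs cs (fun w => w ∈ par cs (I : Set B) ∧ ∀ i ∈ I, cs.IsRightDescent w i) := by
  ext k
  have e : ∀ m : ℕ, (-1 : PowerSeries ℚ) ^ m = PowerSeries.C ((-1 : ℚ) ^ m) := by intro m; simp
  simp only [map_sum, e, PowerSeries.coeff_C_mul]
  simp only [gs, PowerSeries.coeff_mk, Finset.card_filter]
  push_cast
  simp only [Finset.mul_sum]
  rw [Finset.sum_comm]
  refine Finset.sum_congr rfl fun w _ => ?_
  by_cases hw : w ∈ par cs (I : Set B)
  · simp only [hw, true_and, mul_ite, mul_one, mul_zero]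
    rw [← Finset.sum_filter]
    have : (I.powerset.filter fun J => ∀ i ∈ J, ¬ cs.IsRightDescent w i) =
        (I.filter fun i => ¬ cs.IsRightDescent w i).powerset := by
      ext J
      simp only [Finset.mem_filter, Finset.mem_powerset, Finset.subset_iff]
      exact ⟨fun h i hi => ⟨h.1 hi, h.2 i hi⟩, fun h => ⟨fun i hi => (h hi).1, fun i hi => (h hi).2⟩⟩
    rw [this]
    have h2 := Finset.sum_powerset_neg_one_pow_card (x := I.filter fun i => ¬ cs.IsRightDescent w i)
    have h3 := congrArg (Int.cast : ℤ → ℚ) h2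
    push_cast at h3
    rw [h3]
    simp only [Finset.filter_eq_empty_iff, not_not]
  · simp [hw]

/-- Poincare series of parabolic -/
noncomputable def gP (I : Finset B) : PowerSeries ℚ := gs cs (fun w => w ∈ par cs (I : Set B))
/-- Extremal series -/
noncomputable def gE (I : Finset B) : PowerSeries ℚ :=
  gs cs (fun w => w ∈ par cs (I : Set B) ∧ ∀ i ∈ I, cs.IsRightDescent w i)

lemma gP_const (I : Finset B) : PowerSeries.constantCoeff (gP cs I) = 1 := by
  rw [← PowerSeries.coeff_zero_eq_constantCoeff_apply]
  simp only [gP, gs, PowerSeries.coeff_mk]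
  have : (lev cs 0).filter (fun w => w ∈ par cs (I : Set B)) = {1} := by
    ext w
    simp only [Finset.mem_filter, mem_lev, Finset.mem_singleton, cs.length_eq_zero_iff]
    constructor
    · exact fun h => h.1
    · rintro rfl; exact ⟨rfl, one_mem _⟩
  rw [this]; simp

lemma gP_inv (I : Finset B) : gP cs I * (gP cs I)⁻¹ = 1 :=
  PowerSeries.mul_inv_cancel _ (by rw [gP_const]; exact one_ne_zero)

lemma gP_alt (I : Finset B) :
    ∑ J ∈ I.powerset, (-1 : PowerSeries ℚ) ^ J.card * (gP cs J)⁻¹ = gE cs I * (gP cs I)⁻¹ := by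
  rw [gE, ← gs_alt, Finset.sum_mul]
  refine Finset.sum_congr rfl fun J hJ => ?_
  have h := gs_mul cs (Finset.mem_powerset.1 hJ)
  change gP cs I = _ * gP cs J at h
  set Y := gs cs (fun w => w ∈ par cs (I : Set B) ∧ ∀ i ∈ J, ¬ cs.IsRightDescent w i)
  have h1 := gP_inv cs I
  have h2 := gP_inv cs J
  rw [mul_assoc]
  congr 1
  calc (gP cs J)⁻¹ = (gP cs J)⁻¹ * (gP cs I * (gP cs I)⁻¹) := by rw [h1, mul_one]
    _ = Y * (gP cs J * (gP cs J)⁻¹) * (gP cs I)⁻¹ := by nth_rw 1 [h]; ring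
    _ = _ := by rw [h2, mul_one]

lemma alt_sup {B : Type*} [Fintype B] {R : Type*} [CommRing R] (K : Finset B) :
    ∑ J : Finset B, (if K ⊆ J then (-1 : R) ^ J.card else 0) =
      if K = Finset.univ then (-1) ^ Fintype.card B else 0 := by
  rw [← Finset.sum_filter]
  have : ∑ J ∈ Finset.univ.filter (fun J => K ⊆ J), (-1 : R) ^ J.card =
      ∑ L ∈ (Kᶜ).powerset, (-1 : R) ^ K.card * (-1) ^ L.card := by
    symm
    refine Finset.sum_bij (fun L _ => K ∪ L) ?_ ?_ ?_ ?_
    · intro L _; simp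
    · intro L hL L' hL' h
      rw [Finset.mem_powerset, Finset.subset_compl_comm, Finset.subset_compl_iff_disjoint_left] at hL hL'
      have := congrArg (· \ K) h
      simpa [Finset.union_sdiff_cancel_left, hL, hL', hL.symm, hL'.symm] using this
    · intro J hJ
      simp only [Finset.mem_filter, Finset.mem_univ, true_and] at hJ
      refine ⟨J \ K, ?_, by simp [hJ]⟩
      rw [Finset.mem_powerset]; intro x; simp
    · intro L hL
      rw [Finset.mem_powerset, Finset.subset_compl_comm, Finset.subset_compl_iff_disjoint_left] at hL
      rw [Finset.card_union_of_disjoint (by first | exact hL | exact hL.symm), pow_add]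
  rw [this, ← Finset.mul_sum]
  have h2 := Finset.sum_powerset_neg_one_pow_card (x := Kᶜ)
  have h3 := congrArg (Int.cast : ℤ → R) h2
  push_cast at h3
  rw [h3]
  by_cases hK : K = Finset.univ
  · subst hK; simp
  · simp [hK]

lemma gP_main :
    (gP cs Finset.univ)⁻¹ = ∑ J : Finset B, (-1 : PowerSeries ℚ) ^ J.card * (gE cs J * (gP cs J)⁻¹) := by
  simp only [← gP_alt]
  have : ∀ J : Finset B, (-1 : PowerSeries ℚ) ^ J.card *
      ∑ K ∈ J.powerset, (-1 : PowerSeries ℚ) ^ K.card * (gP cs K)⁻¹ =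
      ∑ K : Finset B, (-1 : PowerSeries ℚ) ^ K.card * (gP cs K)⁻¹ *
        (if K ⊆ J then (-1) ^ J.card else 0) := by
    intro J
    rw [Finset.mul_sum]
    simp only [mul_ite, mul_zero]
    rw [← Finset.sum_filter]
    refine Finset.sum_congr ?_ fun K _ => by ring
    ext K; simp
  simp only [this]
  rw [Finset.sum_comm]
  simp only [← Finset.mul_sum, alt_sup]
  simp only [mul_ite, mul_zero, Finset.sum_ite_eq', Finset.mem_univ, if_true, Finset.card_univ]
  rw [mul_right_comm, ← pow_add, ← two_mul, pow_mul]
  simp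
end GF

section CartanPart

lemma refl_rel {R : Type*} [Ring R] (x y : R) (p : ℤ) (hx : x * x = 2 * x) (hy : y * y = 2 * y)
    (hxy : x * y * x = p • x) (hyx : y * x * y = p • y) :
    ((1 - x) * (1 - y)) ^ 3 + (1 - p) • ((1 - x) * (1 - y)) ^ 2
      + (p - 1) • ((1 - x) * (1 - y)) - 1 = 0 := by
  set r := (1 - x) * (1 - y) with hr
  set q := (1 - y) * (1 - x) with hq
  have hrq : r * q = 1 := by
    have : r * q = 1 - 2 * x + x * x - (1 - x) * (2 * y - y * y) * (1 - x) := by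
      rw [hr, hq]; noncomm_ring
    rw [this, hx, hy]; noncomm_ring
  set c := x * y + y * x - 2 * x - 2 * y with hc
  have hcx : c * x = (p - 4) • x := by
    have : c * x = x * y * x + y * (x * x) - 2 * (x * x) - 2 * (y * x) := by rw [hc]; noncomm_ring
    rw [this, hxy, hx, sub_smul]; noncomm_ring
  have hcy : c * y = (p - 4) • y := by
    have : c * y = x * (y * y) + y * x * y - 2 * (x * y) - 2 * (y * y) := by rw [hc]; noncomm_ring
    rw [this, hyx, hy, sub_smul]; noncomm_ring
  have h1 : r - 1 = - x - y + x * y := by rw [hr]; noncomm_ring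
  have h2 : c * (r - 1) = (p - 4) • (r - 1) := by
    have : c * (r - 1) = - (c * x) - c * y + (c * x) * y := by rw [h1]; noncomm_ring
    rw [this, hcx, hcy, h1]; simp only [smul_add, smul_sub, smul_neg, smul_mul_assoc]
  have h3 : r + q = 2 + c := by
    rw [hr, hq, hc, ← one_add_one_eq_two]; noncomm_ring
  have h4 : r * (c * (r - 1)) = (r * r + 1 - 2 * r) * (r - 1) := by
    have : c = r + q - 2 := by rw [h3]; noncomm_ring
    rw [this]
    have : r * ((r + q - 2) * (r - 1)) = (r * r + r * q - 2 * r) * (r - 1) := by noncomm_ring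
    rw [this, hrq]
  rw [h2] at h4
  have h5 : r * ((p - 4) • (r - 1)) = (p - 4) • (r * r - r) := by
    rw [mul_smul_comm, mul_sub, mul_one]
  rw [h5] at h4
  have h6 : r ^ 3 + (1 - p) • r ^ 2 + (p - 1) • r - 1 =
      (r * r + 1 - 2 * r) * (r - 1) - (p - 4) • (r * r - r) := by
    simp only [sub_smul, smul_sub, pow_succ, pow_zero, one_mul]
    noncomm_ring
  rw [h6, h4, sub_self]

/-- rank one matrices -/
def rkOne {n : ℕ} (A : Matrix (Fin n) (Fin n) ℤ) (i j : Fin n) : Matrix (Fin n) (Fin n) ℤ :=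
  Matrix.of fun a b => if a = i then A j b else 0

lemma rkOne_mul {n : ℕ} (A : Matrix (Fin n) (Fin n) ℤ) (i j k l : Fin n) :
    rkOne A i j * rkOne A k l = A j k • rkOne A i l := by
  ext a b
  simp only [rkOne, Matrix.mul_apply, Matrix.of_apply, Matrix.smul_apply, smul_eq_mul]
  by_cases h : a = i <;> simp [h]

/-- reflections -/
def cRefl {n : ℕ} (A : Matrix (Fin n) (Fin n) ℤ) (i : Fin n) : Matrix (Fin n) (Fin n) ℤ :=
  1 - rkOne A i i

lemma cRefl_liftable {n : ℕ} (A : Matrix (Fin n) (Fin n) ℤ) (hA : IsGCM A) :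
    (gcmCoxeter A).IsLiftable (cRefl A) := by
  intro i j
  have hsq : ∀ i, rkOne A i i * rkOne A i i = 2 * rkOne A i i := by
    intro i; rw [rkOne_mul, hA.diag, two_smul, two_mul]
  have hM : (gcmCoxeter A) i j = if i = j then 1 else gcmEntry (A i j * A j i) := rfl
  rw [hM]
  split_ifs with hij
  · subst hij
    rw [pow_one, cRefl]
    have : (1 - rkOne A i i) * (1 - rkOne A i i) = 1 - 2 * rkOne A i i + rkOne A i i * rkOne A i i := by
      noncomm_ring
    rw [this, hsq]; noncomm_ring
  · have hxy : ∀ i j, rkOne A i i * rkOne A j j * rkOne A i i = (A i j * A j i) • rkOne A i i := by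
      intro i j
      rw [rkOne_mul, smul_mul_assoc, rkOne_mul, smul_smul]
    have hxy2 := hxy j i
    rw [mul_comm (A j i)] at hxy2
    have key := refl_rel _ _ _ (hsq i) (hsq j) (hxy i j) hxy2
    change ((1 - rkOne A i i) * (1 - rkOne A j j)) ^ _ = 1
    set r := (1 - rkOne A i i) * (1 - rkOne A j j) with hr
    unfold gcmEntry
    split_ifs with h0 h1 h2 h3
    · have hz : A i j = 0 ∧ A j i = 0 := by
        rcases mul_eq_zero.1 h0 with h | h
        · exact ⟨h, hA.zero_symm _ _ h⟩
        · exact ⟨hA.zero_symm _ _ h, h⟩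
      have c1 : rkOne A i i * rkOne A j j = 0 := by rw [rkOne_mul, hz.1, zero_smul]
      have c2 : rkOne A j j * rkOne A i i = 0 := by rw [rkOne_mul, hz.2, zero_smul]
      have hr1 : r = 1 - rkOne A i i - rkOne A j j := by
        rw [hr]
        have : ∀ x y : Matrix (Fin n) (Fin n) ℤ, (1 - x) * (1 - y) = 1 - x - y + x * y := by
          intros; noncomm_ring
        rw [this, c1, add_zero]
      have : ∀ x y : Matrix (Fin n) (Fin n) ℤ, (1 - x - y) ^ 2 =
          1 + (x * x - 2 * x) + (y * y - 2 * y) + x * y + y * x := by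
        intros; noncomm_ring
      rw [hr1, this, c1, c2, hsq, hsq]; simp
    · rw [h1] at key
      simp only [sub_self, zero_smul, add_zero] at key
      exact sub_eq_zero.1 key
    · rw [h2] at key
      have e : r ^ 3 - r ^ 2 + r - 1 = 0 := by rw [← key]; norm_num; abel
      have : r ^ 4 - 1 = (r + 1) * (r ^ 3 - r ^ 2 + r - 1) := by noncomm_ring
      rw [← sub_eq_zero, this, e, mul_zero]
    · rw [h3] at key
      have e : r ^ 3 - 2 * r ^ 2 + 2 * r - 1 = 0 := by
        rw [← key]; norm_num; noncomm_ring
      have : r ^ 6 - 1 = (r ^ 3 + 2 * r ^ 2 + 2 * r + 1) * (r ^ 3 - 2 * r ^ 2 + 2 * r - 1) := by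
        noncomm_ring
      rw [← sub_eq_zero, this, e, mul_zero]
    · simp

lemma gcm_simple_inj {n : ℕ} (A : Matrix (Fin n) (Fin n) ℤ) (hA : IsGCM A) :
    Function.Injective (gcmCoxeter A).toCoxeterSystem.simple := by
  intro i j h
  by_contra hij
  have h2 := congrArg ((gcmCoxeter A).toCoxeterSystem.lift ⟨_, cRefl_liftable A hA⟩) h
  rw [CoxeterSystem.lift_apply_simple, CoxeterSystem.lift_apply_simple] at h2
  have h3 := congrFun (congrFun h2 i) i
  simp [cRefl, rkOne, hij, hA.diag] at h3
end CartanPart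

section ChainPart
variable {n : ℕ}

/-- number of chains of length r from univ to I -/
noncomputable def chB : ℕ → Finset (Fin n) → ℤ
  | 0, I => if I = Finset.univ then 1 else 0
  | r + 1, I => ∑ J : Finset (Fin n), if I < J then chB r J else 0

lemma sum_snoc {r : ℕ} (F : (Fin (r + 2) → Finset (Fin n)) → ℤ) :
    ∑ c : Fin (r + 2) → Finset (Fin n), F c =
      ∑ c : Fin (r + 1) → Finset (Fin n), ∑ I : Finset (Fin n),
        F (Fin.snoc (α := fun _ => Finset (Fin n)) c I) := by
  rw [← (Fin.snocEquiv (fun _ : Fin (r + 2) => Finset (Fin n))).sum_comp, Fintype.sum_prod_type,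
    Finset.sum_comm]
  rfl

lemma strictAnti_snoc {r : ℕ} (c : Fin (r + 1) → Finset (Fin n)) (I : Finset (Fin n)) :
    StrictAnti (Fin.snoc (α := fun _ => Finset (Fin n)) c I : Fin (r + 2) → Finset (Fin n)) ↔
      StrictAnti c ∧ I < c (Fin.last r) := by
  rw [Fin.strictAnti_iff_succ_lt, Fin.strictAnti_iff_succ_lt, Fin.forall_fin_succ']
  simp only [Fin.succ_castSucc, Fin.snoc_castSucc, Fin.succ_last, Fin.snoc_last]

lemma snoc_zero' {r : ℕ} (c : Fin (r + 1) → Finset (Fin n)) (I : Finset (Fin n)) :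
    (Fin.snoc (α := fun _ => Finset (Fin n)) c I : Fin (r + 2) → Finset (Fin n)) 0 = c 0 := by
  have : (0 : Fin (r + 2)) = Fin.castSucc 0 := rfl
  rw [this, Fin.snoc_castSucc]

lemma chain_sum (r : ℕ) (F : Finset (Fin n) → ℤ) :
    ∑ c : Fin (r + 1) → Finset (Fin n),
      (if c 0 = Finset.univ ∧ StrictAnti c then F (c (Fin.last r)) else 0) =
      ∑ I : Finset (Fin n), chB r I * F I := by
  induction r generalizing F with
  | zero =>
    rw [← (Equiv.funUnique (Fin 1) (Finset (Fin n))).symm.sum_comp]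
    refine Finset.sum_congr rfl fun I _ => ?_
    have hs : StrictAnti ((Equiv.funUnique (Fin 1) (Finset (Fin n))).symm I) :=
      Subsingleton.strictAnti _
    simp only [hs, and_true, chB]
    simp
  | succ r ih =>
    rw [sum_snoc]
    have : ∀ c : Fin (r + 1) → Finset (Fin n), (∑ I : Finset (Fin n),
        if (Fin.snoc (α := fun _ => Finset (Fin n)) c I : Fin (r + 2) → Finset (Fin n)) 0 = Finset.univ ∧
          StrictAnti (Fin.snoc (α := fun _ => Finset (Fin n)) c I : Fin (r + 2) → Finset (Fin n)) then
          F ((Fin.snoc (α := fun _ => Finset (Fin n)) c I : Fin (r + 2) → Finset (Fin n))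
            (Fin.last (r + 1))) else 0) =
        if c 0 = Finset.univ ∧ StrictAnti c then
          (fun J => ∑ I : Finset (Fin n), if I < J then F I else 0) (c (Fin.last r)) else 0 := by
      intro c
      simp only [snoc_zero', strictAnti_snoc, Fin.snoc_last]
      by_cases h : c 0 = Finset.univ ∧ StrictAnti c
      · simp only [h, true_and, and_self, if_true]
      · rw [if_neg h]
        refine Finset.sum_eq_zero fun I _ => if_neg ?_
        tauto
    rw [Finset.sum_congr rfl (fun c _ => this c)]
    refine (ih (fun J => ∑ I : Finset (Fin n), if I < J then F I else 0)).trans ?_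
    simp only [Finset.mul_sum]
    rw [Finset.sum_comm]
    refine Finset.sum_congr rfl fun I _ => ?_
    rw [chB, Finset.sum_mul]
    refine Finset.sum_congr rfl fun J _ => ?_
    split_ifs <;> simp

lemma alt_supF (K : Finset (Fin n)) :
    ∑ J : Finset (Fin n), (if K ⊆ J then (-1 : ℤ) ^ J.card else 0) =
      if K = Finset.univ then (-1) ^ n else 0 := by
  have := alt_sup (R := ℤ) K
  rw [Fintype.card_fin] at this
  convert this

lemma chB_alt (m : ℕ) (I : Finset (Fin n)) (hm : n < m + I.card) :
    ∑ r ∈ Finset.range m, (-1 : ℤ) ^ r * chB r I = (-1) ^ n * (-1) ^ I.card := by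
  induction m generalizing I with
  | zero =>
    have := Finset.card_le_univ I
    simp at this; omega
  | succ m ih =>
    rw [Finset.sum_range_succ']
    have h1 : ∑ r ∈ Finset.range m, (-1 : ℤ) ^ (r + 1) * chB (r + 1) I =
        - ∑ J : Finset (Fin n), if I < J then (-1 : ℤ) ^ n * (-1) ^ J.card else 0 := by
      simp only [chB, Finset.mul_sum]
      rw [Finset.sum_comm, ← Finset.sum_neg_distrib]
      refine Finset.sum_congr rfl fun J _ => ?_
      split_ifs with h
      · have := Finset.card_lt_card h
        rw [← ih J (by omega), ← Finset.sum_neg_distrib]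
        refine Finset.sum_congr rfl fun r _ => by ring
      · simp
    rw [h1]
    have h2 := alt_supF I
    have h3 : ∑ J : Finset (Fin n), (if I ⊆ J then (-1 : ℤ) ^ J.card else 0) =
        (∑ J : Finset (Fin n), if I < J then (-1 : ℤ) ^ J.card else 0) + (-1) ^ I.card := by
      have : ((-1 : ℤ) ^ I.card) = ∑ J : Finset (Fin n), if J = I then (-1 : ℤ) ^ J.card else 0 := by
        simp
      rw [this, ← Finset.sum_add_distrib]
      refine Finset.sum_congr rfl fun J _ => ?_
      by_cases hJ : J = I
      · subst hJ; simp
      · have : I < J ↔ I ⊆ J := ⟨fun h => h.le, fun h => lt_of_le_of_ne h (Ne.symm hJ)⟩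
        simp [hJ, this]
    rw [h3] at h2
    have h4 : ∑ J : Finset (Fin n), (if I < J then (-1 : ℤ) ^ n * (-1) ^ J.card else 0) =
        (-1) ^ n * ∑ J : Finset (Fin n), (if I < J then (-1 : ℤ) ^ J.card else 0) := by
      rw [Finset.mul_sum]; refine Finset.sum_congr rfl fun J _ => by split_ifs <;> simp
    rw [h4, eq_sub_of_add_eq h2]
    have h5 : (-1 : ℤ) ^ n * (-1) ^ n = 1 := by rw [← mul_pow]; simp
    by_cases hI : I = Finset.univ
    · simp only [hI, chB, if_true, Fintype.card_fin]
      simp only [Finset.card_univ, Fintype.card_fin, h5]; simp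
    · simp only [hI, chB, if_false]; ring

variable (X : Finset (Fin n) → Prop)

lemma K0_aux (hup : ∀ I J, I ⊆ J → X I → X J) (he : ¬ X ∅) :
    (∑ r ∈ Finset.range n, ∑ c : Fin (r + 1) → Finset (Fin n),
      if IsGCMChain c ∧ ∀ j, X (c j) then (-1 : ℤ) ^ (n + r + 1) else 0) =
    - ∑ I : Finset (Fin n), if X I then (-1) ^ I.card else 0 := by
  have h1 : ∀ r, (∑ c : Fin (r + 1) → Finset (Fin n),
      if IsGCMChain c ∧ ∀ j, X (c j) then (-1 : ℤ) ^ (n + r + 1) else 0) =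
      ∑ I : Finset (Fin n), chB r I * (if X I then (-1 : ℤ) ^ (n + r + 1) else 0) := by
    intro r
    rw [← chain_sum r (fun I => if X I then (-1 : ℤ) ^ (n + r + 1) else 0)]
    refine Finset.sum_congr rfl fun c _ => ?_
    rw [← ite_and]
    congr 1
    apply propext
    unfold IsGCMChain
    constructor
    · rintro ⟨⟨a, b, _⟩, d⟩; exact ⟨⟨a, b⟩, d _⟩
    · rintro ⟨⟨a, b⟩, d⟩
      refine ⟨⟨a, b, ?_⟩, fun j => hup _ _ (b.antitone (Fin.le_last j)) d⟩
      intro h; rw [h] at d; exact he d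
  simp only [h1]
  rw [Finset.sum_comm, ← Finset.sum_neg_distrib]
  refine Finset.sum_congr rfl fun I _ => ?_
  by_cases hI : X I
  · simp only [hI, if_true]
    have hc : 0 < I.card := by
      rw [Finset.card_pos, Finset.nonempty_iff_ne_empty]; rintro rfl; exact he hI
    have h5 : (-1 : ℤ) ^ n * (-1) ^ n = 1 := by rw [← mul_pow]; simp
    have := chB_alt n I (by omega)
    calc _ = -(-1) ^ n * ∑ r ∈ Finset.range n, (-1 : ℤ) ^ r * chB r I := by
          rw [Finset.mul_sum]; refine Finset.sum_congr rfl fun r _ => by ring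
      _ = _ := by rw [this, ← mul_assoc, neg_mul, h5]; simp
  · simp [hI]

lemma K1_aux (h1 : ∀ i, ¬ X {i}) (he : ¬ X ∅) (hup : ∀ I J, I ⊆ J → X I → X J) (hn : 2 ≤ n) :
    (∑ r ∈ Finset.range n, ∑ c : Fin (r + 1) → Finset (Fin n),
      if IsGCMChain c ∧ (∀ j : Fin r, X (c j.castSucc)) ∧ (c (Fin.last r)).card = 1 then
        (-1 : ℤ) ^ (n + r + 1) else 0) =
    ∑ I : Finset (Fin n), if X I then (-1) ^ I.card * (I.card : ℤ) else 0 := by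
  obtain ⟨m, rfl⟩ : ∃ m, n = m + 2 := ⟨n - 2, by omega⟩
  rw [Finset.sum_range_succ']
  have z : (∑ c : Fin (0 + 1) → Finset (Fin (m + 2)),
      if IsGCMChain c ∧ (∀ j : Fin 0, X (c j.castSucc)) ∧ (c (Fin.last 0)).card = 1 then
        (-1 : ℤ) ^ (m + 2 + 0 + 1) else 0) = 0 := by
    refine Finset.sum_eq_zero fun c _ => if_neg ?_
    rintro ⟨⟨a, _⟩, _, d⟩
    have : Fin.last 0 = 0 := rfl
    rw [this, a] at d
    simp at d
  rw [z, add_zero]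
  have h2 : ∀ r, (∑ c : Fin (r + 1 + 1) → Finset (Fin (m + 2)),
      if IsGCMChain c ∧ (∀ j : Fin (r + 1), X (c j.castSucc)) ∧ (c (Fin.last (r + 1))).card = 1 then
        (-1 : ℤ) ^ (m + 2 + (r + 1) + 1) else 0) =
      ∑ I : Finset (Fin (m + 2)), chB r I *
        (if X I then (-1 : ℤ) ^ (m + 2 + (r + 1) + 1) * (I.card : ℤ) else 0) := by
    intro r
    rw [← chain_sum r (fun I => if X I then (-1 : ℤ) ^ (m + 2 + (r + 1) + 1) * (I.card : ℤ) else 0),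
      sum_snoc]
    refine Finset.sum_congr rfl fun c _ => ?_
    rw [← ite_and]
    simp only [IsGCMChain, snoc_zero', strictAnti_snoc, Fin.snoc_last, Fin.snoc_castSucc]
    split_ifs with h
    · obtain ⟨⟨a, b⟩, d⟩ := h
      have hX : ∀ j, X (c j) := fun j => hup _ _ (b.antitone (Fin.le_last j)) d
      rw [← Finset.sum_filter, Finset.sum_const, nsmul_eq_mul, mul_comm]
      congr 2
      have hp : (c (Fin.last r)).card = (Finset.powersetCard 1 (c (Fin.last r))).card := by simp
      rw [hp]
      congr 1
      ext I
      simp only [Finset.mem_filter, Finset.mem_univ, true_and, Finset.mem_powersetCard]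
      constructor
      · rintro ⟨⟨_, ⟨_, e⟩, _⟩, _, f⟩; exact ⟨e.le, f⟩
      · rintro ⟨e, f⟩
        refine ⟨⟨a, ⟨b, lt_of_le_of_ne e ?_⟩, ?_⟩, hX, f⟩
        · rintro rfl
          obtain ⟨i, hi⟩ := Finset.card_eq_one.1 f
          rw [hi] at d; exact h1 i d
        · rintro rfl; simp at f
    · refine Finset.sum_eq_zero fun I _ => if_neg ?_
      rintro ⟨⟨a, ⟨b, _⟩, _⟩, d, _⟩
      exact h ⟨⟨a, b⟩, d _⟩
  simp only [h2]
  rw [Finset.sum_comm]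
  refine Finset.sum_congr rfl fun I _ => ?_
  by_cases hI : X I
  · simp only [hI, if_true]
    have hc : 2 ≤ I.card := by
      by_contra hlt
      have : I.card = 0 ∨ I.card = 1 := by omega
      rcases this with h | h
      · rw [Finset.card_eq_zero] at h; subst h; exact he hI
      · obtain ⟨i, rfl⟩ := Finset.card_eq_one.1 h; exact h1 i hI
    have h5 : (-1 : ℤ) ^ (m + 2) * (-1) ^ (m + 2) = 1 := by rw [← mul_pow]; simp
    have := chB_alt (m + 1) I (by omega)
    calc _ = (-1) ^ (m + 2) * I.card * ∑ r ∈ Finset.range (m + 1), (-1 : ℤ) ^ r * chB r I := by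
          rw [Finset.mul_sum]; refine Finset.sum_congr rfl fun r _ => by ring
      _ = ((-1) ^ (m + 2) * (-1) ^ (m + 2)) * ((-1) ^ I.card * I.card) := by rw [this]; ring
      _ = _ := by rw [h5, one_mul]
  · simp [hI]

lemma alt_univ (hn : 1 ≤ n) : ∑ I : Finset (Fin n), (-1 : ℤ) ^ I.card = 0 := by
  have := alt_supF (∅ : Finset (Fin n))
  simp only [Finset.empty_subset, if_true] at this
  rw [this, if_neg]
  intro h
  have := congrArg Finset.card h
  simp at this; omega

lemma alt_univ_card (hn : 2 ≤ n) : ∑ I : Finset (Fin n), (-1 : ℤ) ^ I.card * (I.card : ℤ) = 0 := by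
  have h : ∀ I : Finset (Fin n), (-1 : ℤ) ^ I.card * (I.card : ℤ) =
      ∑ j : Fin n, if {j} ⊆ I then (-1 : ℤ) ^ I.card else 0 := by
    intro I
    simp only [Finset.singleton_subset_iff]
    rw [← Finset.sum_filter, Finset.sum_const, nsmul_eq_mul, mul_comm]
    congr 3
    ext; simp
  simp only [h]
  rw [Finset.sum_comm]
  refine Finset.sum_eq_zero fun j _ => ?_
  rw [alt_supF, if_neg]
  intro h
  have := congrArg Finset.card h
  simp at this; omega

lemma K0_fin (hup : ∀ I J, I ⊆ J → X I → X J) (he : ¬ X ∅) (hn : 2 ≤ n) :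
    (∑ r ∈ Finset.range n, ∑ c : Fin (r + 1) → Finset (Fin n),
      if IsGCMChain c ∧ ∀ j, X (c j) then (-1 : ℤ) ^ (n + r + 1) else 0) =
    ∑ I : Finset (Fin n), if X I then 0 else (-1) ^ I.card := by
  rw [K0_aux X hup he]
  have := alt_univ (n := n) (by omega)
  have e : ∑ I : Finset (Fin n), (-1 : ℤ) ^ I.card =
      (∑ I : Finset (Fin n), if X I then (-1) ^ I.card else 0) +
      ∑ I : Finset (Fin n), if X I then 0 else (-1) ^ I.card := by
    rw [← Finset.sum_add_distrib]
    refine Finset.sum_congr rfl fun I _ => by split_ifs <;> simp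
  linarith

lemma K1_fin (h1 : ∀ i, ¬ X {i}) (he : ¬ X ∅) (hup : ∀ I J, I ⊆ J → X I → X J) (hn : 2 ≤ n) :
    (∑ r ∈ Finset.range n, ∑ c : Fin (r + 1) → Finset (Fin n),
      if IsGCMChain c ∧ (∀ j : Fin r, X (c j.castSucc)) ∧ (c (Fin.last r)).card = 1 then
        (-1 : ℤ) ^ (n + r + 1) else 0) =
    - ∑ I : Finset (Fin n), if X I then 0 else (-1) ^ I.card * (I.card : ℤ) := by
  rw [K1_aux X h1 he hup hn]
  have := alt_univ_card (n := n) hn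
  have e : ∑ I : Finset (Fin n), (-1 : ℤ) ^ I.card * (I.card : ℤ) =
      (∑ I : Finset (Fin n), if X I then (-1) ^ I.card * (I.card : ℤ) else 0) +
      ∑ I : Finset (Fin n), if X I then 0 else (-1) ^ I.card * (I.card : ℤ) := by
    rw [← Finset.sum_add_distrib]
    refine Finset.sum_congr rfl fun I _ => by split_ifs <;> simp
  linarith
end ChainPart


section Final
variable {B : Type*} [Fintype B] {W : Type*} [Group W] {M : CoxeterMatrix B}
  (cs : CoxeterSystem M W)

lemma fin_of_ext {J : Finset B} {w : W} (hw : ∀ i ∈ J, cs.IsRightDescent w i) :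
    Finite (par cs (J : Set B)) := by
  have : Set.Finite (⋃ k ∈ Set.Iic (cs.length w), {u : W | cs.length u = k}) :=
    (Set.finite_Iic _).biUnion fun k _ => level_finite cs k
  refine (this.subset ?_ : Set.Finite (par cs (J : Set B) : Set W))
  intro u hu
  have := longest_sub cs (I := (J : Set B)) (by exact_mod_cast hw) hu
  simp only [Set.mem_iUnion]
  exact ⟨cs.length u, by rw [Set.mem_Iic]; omega, rfl⟩

lemma gs_coeff_zero {p : W → Prop} {k : ℕ} (h : ∀ w, cs.length w = k → ¬ p w) :
    PowerSeries.coeff k (gs cs p) = 0 := by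
  simp only [gs, PowerSeries.coeff_mk]
  rw [Finset.filter_eq_empty_iff.2]
  · simp
  · intro w hw; exact h w ((mem_lev cs).1 hw)

lemma gs_coeff_one {p : W → Prop} {k : ℕ} (v : W)
    (h : ∀ w, (cs.length w = k ∧ p w) ↔ w = v) :
    PowerSeries.coeff k (gs cs p) = 1 := by
  simp only [gs, PowerSeries.coeff_mk]
  have : (lev cs k).filter p = {v} := by
    ext w
    simp only [Finset.mem_filter, mem_lev, Finset.mem_singleton, h]
  rw [this]; simp

lemma gE_inf {J : Finset B} (h : ¬ Finite (par cs (J : Set B))) : gE cs J = 0 := by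
  ext k
  rw [map_zero]
  exact gs_coeff_zero cs fun w _ hw => h (fin_of_ext cs hw.2)

lemma exists_longest {J : Finset B} (h : Finite (par cs (J : Set B))) :
    ∃ w ∈ par cs (J : Set B), ∀ i ∈ J, cs.IsRightDescent w i := by
  have hf : Set.Finite (par cs (J : Set B) : Set W) := h
  obtain ⟨w, hw, hmax⟩ := Set.exists_max_image _ cs.length hf ⟨1, one_mem _⟩
  refine ⟨w, hw, fun i hi => ?_⟩
  have h1 := hmax (w * cs.simple i) (mul_mem hw (Subgroup.subset_closure ⟨i, hi, rfl⟩))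
  have h2 := cs.length_mul_simple_ne w i
  exact lt_of_le_of_ne h1 h2

lemma gE_fin {J : Finset B} {w : W} (hwJ : w ∈ par cs (J : Set B))
    (hw : ∀ i ∈ J, cs.IsRightDescent w i) : gE cs J = PowerSeries.X ^ cs.length w := by
  have uniq : ∀ v ∈ par cs (J : Set B), (∀ i ∈ J, cs.IsRightDescent v i) → v = w := by
    intro v hvJ hv
    have h1 := longest_sub cs (I := (J : Set B)) (by exact_mod_cast hw) hvJ
    have h2 := longest_sub cs (I := (J : Set B)) (by exact_mod_cast hv) hwJ
    have h3 : cs.length (v * w⁻¹) = 0 := by omega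
    rw [cs.length_eq_zero_iff] at h3
    exact mul_inv_eq_one.1 h3
  ext k
  rw [PowerSeries.coeff_X_pow]
  split_ifs with h
  · refine gs_coeff_one cs w fun v => ⟨?_, ?_⟩
    · rintro ⟨_, a, b⟩; exact uniq v a b
    · rintro rfl; exact ⟨h.symm, hwJ, hw⟩
  · refine gs_coeff_zero cs ?_
    rintro v hv ⟨a, b⟩
    rw [uniq v a b] at hv; exact h hv.symm

lemma gP_symm {J : Finset B} {w : W} (hwJ : w ∈ par cs (J : Set B))
    (hw : ∀ i ∈ J, cs.IsRightDescent w i) {k : ℕ} (hk : k ≤ cs.length w) :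
    PowerSeries.coeff (cs.length w - k) (gP cs J) = PowerSeries.coeff k (gP cs J) := by
  simp only [gP, gs, PowerSeries.coeff_mk]
  congr 1
  have L := fun u (hu : u ∈ par cs (J : Set B)) =>
    longest_sub cs (I := (J : Set B)) (by exact_mod_cast hw) hu
  refine Finset.card_bij (fun u _ => w * u⁻¹) ?_ ?_ ?_
  · intro u hu
    simp only [Finset.mem_filter, mem_lev] at hu ⊢
    exact ⟨by have := L u hu.2; omega, mul_mem hwJ (inv_mem hu.2)⟩
  · intro u _ v _ h; simpa using h
  · intro u hu
    simp only [Finset.mem_filter, mem_lev] at hu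
    refine ⟨u⁻¹ * w, ?_, by simp⟩
    simp only [Finset.mem_filter, mem_lev]
    have hm : u⁻¹ * w ∈ par cs (J : Set B) := mul_mem (inv_mem hu.2) hwJ
    have := L _ hm
    simp only [mul_inv_rev, inv_inv, mul_inv_cancel_left] at this
    exact ⟨by omega, hm⟩

lemma gP_coeff_one (hinj : Function.Injective cs.simple) (J : Finset B) :
    PowerSeries.coeff 1 (gP cs J) = J.card := by
  simp only [gP, gs, PowerSeries.coeff_mk]
  congr 1
  symm
  refine Finset.card_bij (fun i _ => cs.simple i) ?_ ?_ ?_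
  · intro i hi
    simp only [Finset.mem_filter, mem_lev]
    exact ⟨cs.length_simple i, Subgroup.subset_closure ⟨i, hi, rfl⟩⟩
  · intro i _ j _ h; exact hinj h
  · intro u hu
    simp only [Finset.mem_filter, mem_lev] at hu
    obtain ⟨ω, a, b, rfl⟩ := par_reduced cs hu.2
    have h1 : ω.length = 1 := by rw [← b.eq]; exact hu.1
    obtain ⟨i, rfl⟩ := List.length_eq_one_iff.1 h1
    exact ⟨i, by simpa using a i (by simp), by simp⟩

lemma pol_exists (hinj : Function.Injective cs.simple) {J : Finset B}
    (h : Finite (par cs (J : Set B))) :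
    ∃ p : Polynomial ℚ, (p : PowerSeries ℚ) = gP cs J ∧ p.Monic ∧ p.nextCoeff = J.card ∧
      gE cs J = PowerSeries.X ^ p.natDegree := by
  obtain ⟨w, hwJ, hw⟩ := exists_longest cs h
  set D := cs.length w with hD
  have hc : ∀ k, (PowerSeries.trunc (D + 1) (gP cs J)).coeff k = PowerSeries.coeff k (gP cs J) := by
    intro k
    rw [PowerSeries.coeff_trunc]
    split_ifs with hk
    · rfl
    · symm
      simp only [gP, gs, PowerSeries.coeff_mk]
      rw [Finset.filter_eq_empty_iff.2]
      · simp
      · intro u hu huJ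
        have := longest_sub cs (I := (J : Set B)) (by exact_mod_cast hw) huJ
        rw [mem_lev] at hu; omega
  set p := PowerSeries.trunc (D + 1) (gP cs J) with hp
  have hcD : p.coeff D = 1 := by
    have := gP_symm cs hwJ hw (k := 0) (Nat.zero_le _)
    rw [Nat.sub_zero] at this
    rw [hc, this, PowerSeries.coeff_zero_eq_constantCoeff_apply, gP_const]
  have hdeg : p.natDegree = D := by
    refine le_antisymm ?_ (Polynomial.le_natDegree_of_ne_zero (by rw [hcD]; exact one_ne_zero))
    exact Nat.lt_succ_iff.1 (PowerSeries.natDegree_trunc_lt _ _)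
  refine ⟨p, ?_, ?_, ?_, ?_⟩
  · ext k; rw [Polynomial.coeff_coe, hc]
  · rw [Polynomial.Monic, Polynomial.leadingCoeff, hdeg, hcD]
  · by_cases h0 : D = 0
    · have : J = ∅ := by
        rw [Finset.eq_empty_iff_forall_notMem]
        intro i hi
        have := hw i hi
        rw [CoxeterSystem.IsRightDescent] at this; omega
      rw [Polynomial.nextCoeff, if_pos (hdeg.trans h0), this]; simp
    · rw [Polynomial.nextCoeff, if_neg (by omega), hdeg, hc, gP_symm cs hwJ hw (by omega),
        gP_coeff_one cs hinj]
  · rw [hdeg]; exact gE_fin cs hwJ hw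

end Final

section Poly
open Polynomial
lemma poly_term {ι : Type*} [DecidableEq ι] (s : Finset ι) (p : ι → Polynomial ℚ) (hm : ∀ i ∈ s, (p i).Monic)
    {j : ι} (hj : j ∈ s) :
    (Polynomial.X ^ (p j).natDegree * ∏ k ∈ s.erase j, p k).natDegree = ∑ i ∈ s, (p i).natDegree ∧
    (Polynomial.X ^ (p j).natDegree * ∏ k ∈ s.erase j, p k).Monic ∧
    (Polynomial.X ^ (p j).natDegree * ∏ k ∈ s.erase j, p k).nextCoeff =
      ∑ i ∈ s, (p i).nextCoeff - (p j).nextCoeff := by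
  have hm' : ∀ i ∈ s.erase j, (p i).Monic := fun i hi => hm i (Finset.mem_of_mem_erase hi)
  have h1 : (∏ k ∈ s.erase j, p k).Monic := monic_prod_of_monic _ _ hm'
  have h2 : (Polynomial.X ^ (p j).natDegree : Polynomial ℚ).Monic := monic_X_pow _
  refine ⟨?_, h2.mul h1, ?_⟩
  · rw [h2.natDegree_mul h1, natDegree_X_pow, natDegree_prod_of_monic _ _ hm',
      Finset.add_sum_erase s (fun i => (p i).natDegree) hj]
  · rw [h2.nextCoeff_mul h1, Monic.nextCoeff_prod _ _ hm',
      ← Finset.add_sum_erase s (fun i => (p i).nextCoeff) hj]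
    have : (Polynomial.X ^ (p j).natDegree : Polynomial ℚ).nextCoeff = 0 := by
      rw [nextCoeff]
      split_ifs with h
      · rfl
      · rw [Polynomial.coeff_X_pow, if_neg]
        rw [natDegree_X_pow] at h ⊢; omega
    rw [this]; ring

lemma poly_sum {ι : Type*} [DecidableEq ι] (s : Finset ι) (p : ι → Polynomial ℚ) (hm : ∀ i ∈ s, (p i).Monic)
    (e : ι → ℚ) (hN : 0 < ∑ i ∈ s, (p i).natDegree) :
    (∑ j ∈ s, Polynomial.C (e j) * (Polynomial.X ^ (p j).natDegree * ∏ k ∈ s.erase j, p k)).natDegree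
      ≤ ∑ i ∈ s, (p i).natDegree ∧
    (∑ j ∈ s, Polynomial.C (e j) * (Polynomial.X ^ (p j).natDegree * ∏ k ∈ s.erase j, p k)).coeff
      (∑ i ∈ s, (p i).natDegree) = ∑ j ∈ s, e j ∧
    (∑ j ∈ s, Polynomial.C (e j) * (Polynomial.X ^ (p j).natDegree * ∏ k ∈ s.erase j, p k)).coeff
      (∑ i ∈ s, (p i).natDegree - 1) =
      (∑ i ∈ s, (p i).nextCoeff) * (∑ j ∈ s, e j) - ∑ j ∈ s, e j * (p j).nextCoeff := by
  refine ⟨?_, ?_, ?_⟩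
  · refine natDegree_sum_le_of_forall_le _ _ fun j hj => ?_
    exact (natDegree_C_mul_le _ _).trans (poly_term s p hm hj).1.le
  · rw [finsetSum_coeff]
    refine Finset.sum_congr rfl fun j hj => ?_
    obtain ⟨a, b, _⟩ := poly_term s p hm hj
    rw [Polynomial.coeff_C_mul, ← a, b.coeff_natDegree, mul_one]
  · rw [finsetSum_coeff, Finset.mul_sum, ← Finset.sum_sub_distrib]
    refine Finset.sum_congr rfl fun j hj => ?_
    obtain ⟨a, b, c⟩ := poly_term s p hm hj
    rw [Polynomial.coeff_C_mul, ← a, ← nextCoeff_of_natDegree_pos (by rw [a]; exact hN), c]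
    ring
end Poly

section Main
variable {n : ℕ} (M : CoxeterMatrix (Fin n))

lemma poincare_eq : coxPoincareQ M = gP M.toCoxeterSystem Finset.univ := by
  ext k
  simp only [coxPoincareQ, gP, gs, PowerSeries.coeff_mk]
  congr 1
  refine Nat.subtype_card _ fun w => ?_
  rw [Finset.mem_filter, mem_lev]
  have : w ∈ par M.toCoxeterSystem ((Finset.univ : Finset (Fin n)) : Set (Fin n)) := by
    rw [par, Finset.coe_univ, Set.image_univ, M.toCoxeterSystem.subgroup_closure_range_simple]
    trivial
  exact ⟨fun h => h.1, fun h => ⟨h, this⟩⟩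

lemma key_mul (s : Finset (Finset (Fin n))) (p : Finset (Fin n) → Polynomial ℚ)
    (hs : ∀ J, J ∈ s ↔ Finite (par M.toCoxeterSystem (J : Set (Fin n))))
    (hp : ∀ J ∈ s, (p J : PowerSeries ℚ) = gP M.toCoxeterSystem J ∧
      gE M.toCoxeterSystem J = PowerSeries.X ^ (p J).natDegree) :
    coxPoincareQ M * ((∑ J ∈ s, Polynomial.C ((-1 : ℚ) ^ J.card) *
      (Polynomial.X ^ (p J).natDegree * ∏ K ∈ s.erase J, p K) : Polynomial ℚ) : PowerSeries ℚ) =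
      ((∏ J ∈ s, p J : Polynomial ℚ) : PowerSeries ℚ) := by
  set cs := M.toCoxeterSystem
  have h1 : (gP cs Finset.univ)⁻¹ = ∑ J ∈ s, (-1 : PowerSeries ℚ) ^ J.card *
      (PowerSeries.X ^ (p J).natDegree * (gP cs J)⁻¹) := by
    rw [gP_main cs]
    symm
    refine (Finset.sum_congr rfl fun J hJ => by rw [(hp J hJ).2]).trans
      (Finset.sum_subset (Finset.subset_univ s) fun J _ hJ => ?_)
    rw [hs] at hJ
    rw [gE_inf cs hJ]; simp
  have h2 : ((∑ J ∈ s, Polynomial.C ((-1 : ℚ) ^ J.card) *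
      (Polynomial.X ^ (p J).natDegree * ∏ K ∈ s.erase J, p K) : Polynomial ℚ) : PowerSeries ℚ) =
      ((∏ J ∈ s, p J : Polynomial ℚ) : PowerSeries ℚ) * (gP cs Finset.univ)⁻¹ := by
    rw [h1, Finset.mul_sum]
    have e : ∀ q : Polynomial ℚ, (q : PowerSeries ℚ) = Polynomial.coeToPowerSeries.ringHom q :=
      fun _ => rfl
    rw [e, map_sum]
    refine Finset.sum_congr rfl fun J hJ => ?_
    rw [← Finset.mul_prod_erase s p hJ]
    simp only [← e, Polynomial.coe_mul, Polynomial.coe_pow, Polynomial.coe_X, Polynomial.coe_C]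
    rw [(hp J hJ).1]
    have h3 := gP_inv cs J
    have h4 : PowerSeries.C ((-1 : ℚ) ^ J.card) = (-1 : PowerSeries ℚ) ^ J.card := by simp
    rw [h4]
    calc _ = (-1 : PowerSeries ℚ) ^ J.card * (PowerSeries.X ^ (p J).natDegree *
          ((∏ K ∈ s.erase J, p K : Polynomial ℚ) : PowerSeries ℚ)) * 1 := by rw [mul_one]
      _ = _ := by rw [← h3]; ring
  rw [h2, poincare_eq]
  have h3 := gP_inv cs Finset.univ
  calc _ = ((∏ J ∈ s, p J : Polynomial ℚ) : PowerSeries ℚ) *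
        (gP cs Finset.univ * (gP cs Finset.univ)⁻¹) := by ring
    _ = _ := by rw [h3, mul_one]

lemma par_singleton_finite (i : Fin n) : Finite (par M.toCoxeterSystem (({i} : Finset (Fin n)) : Set (Fin n))) := by
  refine fin_of_ext M.toCoxeterSystem (w := M.toCoxeterSystem.simple i) ?_
  intro j hj
  rw [Finset.mem_singleton] at hj
  subst hj
  rw [CoxeterSystem.IsRightDescent, CoxeterSystem.simple_mul_simple_self, CoxeterSystem.length_one,
    CoxeterSystem.length_simple]; exact Nat.one_pos

lemma par_empty_finite : Finite (par M.toCoxeterSystem ((∅ : Finset (Fin n)) : Set (Fin n))) := by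
  refine fin_of_ext M.toCoxeterSystem (w := 1) ?_
  intro j hj; simp at hj

lemma main_aux (hinj : Function.Injective M.toCoxeterSystem.simple) (hinf : Infinite M.Group) :
    (∃ Q R : Polynomial ℚ, Q ≠ 0 ∧ R ≠ 0 ∧
        (R : PowerSeries ℚ) * coxPoincareQ M = (Q : PowerSeries ℚ) ∧
        R.natDegree + 2 ≤ Q.natDegree) ↔ (K0 M = 0 ∧ K1 M = 0) := by
  set cs := M.toCoxeterSystem with hcs
  let s : Finset (Finset (Fin n)) := Finset.univ.filter fun J => Finite (par cs (J : Set (Fin n)))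
  have hs : ∀ J, J ∈ s ↔ Finite (par cs (J : Set (Fin n))) := by intro J; simp [s]
  have hex : ∀ J, J ∈ s → ∃ p : Polynomial ℚ, (p : PowerSeries ℚ) = gP cs J ∧ p.Monic ∧
      p.nextCoeff = J.card ∧ gE cs J = PowerSeries.X ^ p.natDegree :=
    fun J hJ => pol_exists cs hinj ((hs J).1 hJ)
  choose! p hp using hex
  have hm : ∀ J ∈ s, (p J).Monic := fun J hJ => (hp J hJ).2.1
  -- properties of infinite family
  have hup : ∀ I J : Finset (Fin n), I ⊆ J → Infinite (coxParabolic M I) →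
      Infinite (coxParabolic M J) := by
    intro I J hIJ hI
    rw [← not_finite_iff_infinite] at hI ⊢
    intro hJ
    refine hI (Set.Finite.subset (s := (coxParabolic M J : Set M.Group)) hJ ?_)
    exact Subgroup.closure_mono (Set.image_mono (by exact_mod_cast hIJ))
  have h0 : ¬ Infinite (coxParabolic M (∅ : Finset (Fin n))) := by
    rw [not_infinite_iff_finite]; exact par_empty_finite M
  have h1 : ∀ i, ¬ Infinite (coxParabolic M ({i} : Finset (Fin n))) := by
    intro i; rw [not_infinite_iff_finite]; exact par_singleton_finite M i
  have hU : Infinite (coxParabolic M (Finset.univ : Finset (Fin n))) := by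
    have : coxParabolic M (Finset.univ : Finset (Fin n)) = ⊤ := by
      rw [coxParabolic, Finset.coe_univ, Set.image_univ, cs.subgroup_closure_range_simple]
    rw [this]
    exact (Subgroup.topEquiv (G := M.Group)).toEquiv.infinite_iff.2 hinf
  have hn : 2 ≤ n := by
    by_contra hlt
    have hc : (Finset.univ : Finset (Fin n)).card = 0 ∨ (Finset.univ : Finset (Fin n)).card = 1 := by
      rw [Finset.card_univ, Fintype.card_fin]; omega
    rcases hc with h | h
    · rw [Finset.card_eq_zero] at h; rw [h] at hU; exact h0 hU
    · obtain ⟨i, hi⟩ := Finset.card_eq_one.1 h; rw [hi] at hU; exact h1 i hU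
  have hK0 : ((K0 M : ℤ) : ℚ) = ∑ J ∈ s, (-1 : ℚ) ^ J.card := by
    have := K0_fin (fun I => Infinite (coxParabolic M I)) hup h0 hn
    rw [K0, this]
    push_cast
    rw [Finset.sum_filter]
    refine Finset.sum_congr rfl fun J _ => ?_
    by_cases hJ : Finite (par cs (J : Set (Fin n)))
    · rw [if_pos hJ, if_neg (not_infinite_iff_finite.2 hJ : ¬ Infinite (coxParabolic M J))]
    · rw [if_neg hJ, if_pos (not_finite_iff_infinite.1 hJ : Infinite (coxParabolic M J))]
  have hK1 : ((K1 M : ℤ) : ℚ) = - ∑ J ∈ s, (-1 : ℚ) ^ J.card * (p J).nextCoeff := by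
    have := K1_fin (fun I => Infinite (coxParabolic M I)) h1 h0 hup hn
    rw [K1, this]
    push_cast
    congr 1
    have e : ∑ J ∈ s, (-1 : ℚ) ^ J.card * (p J).nextCoeff = ∑ J ∈ s, (-1 : ℚ) ^ J.card * (J.card : ℚ) :=
      Finset.sum_congr rfl fun J hJ => by rw [(hp J hJ).2.2.1]
    rw [e, Finset.sum_filter]
    refine Finset.sum_congr rfl fun J _ => ?_
    by_cases hJ : Finite (par cs (J : Set (Fin n)))
    · rw [if_pos hJ, if_neg (not_infinite_iff_finite.2 hJ : ¬ Infinite (coxParabolic M J))]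
    · rw [if_neg hJ, if_pos (not_finite_iff_infinite.1 hJ : Infinite (coxParabolic M J))]
  have hN : 0 < ∑ J ∈ s, (p J).natDegree := by
    have i : Fin n := ⟨0, by omega⟩
    have hi : ({i} : Finset (Fin n)) ∈ s := (hs _).2 (par_singleton_finite M i)
    refine lt_of_lt_of_le ?_ (Finset.single_le_sum (f := fun J => (p J).natDegree)
      (fun _ _ => Nat.zero_le _) hi)
    rw [Nat.pos_iff_ne_zero]
    intro hz
    have h2 := (hp _ hi).2.2.1
    rw [Polynomial.nextCoeff, if_pos hz] at h2
    simp at h2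
  obtain ⟨d1, d2, d3⟩ := poly_sum s p hm (fun J => (-1 : ℚ) ^ J.card) hN
  have hkey := key_mul M s p hs (fun J hJ => ⟨(hp J hJ).1, (hp J hJ).2.2.2⟩)
  set Q' := ∑ J ∈ s, Polynomial.C ((-1 : ℚ) ^ J.card) *
      (Polynomial.X ^ (p J).natDegree * ∏ K ∈ s.erase J, p K) with hQ'
  have hRm : (∏ J ∈ s, p J).Monic := Polynomial.monic_prod_of_monic _ _ hm
  have hRd : (∏ J ∈ s, p J).natDegree = ∑ J ∈ s, (p J).natDegree :=
    Polynomial.natDegree_prod_of_monic _ _ hm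
  set R' := ∏ J ∈ s, p J with hR'
  set N := ∑ J ∈ s, (p J).natDegree with hNdef
  have hQ0 : Q' ≠ 0 := by
    intro h
    rw [h, Polynomial.coe_zero, mul_zero] at hkey
    have : R' = 0 := by
      rw [← Polynomial.coe_zero] at hkey
      exact (Polynomial.coe_injective ℚ hkey).symm
    exact hRm.ne_zero this
  have e0 : K0 M = 0 ↔ Q'.coeff N = 0 := by
    rw [d2, ← hK0, Int.cast_eq_zero]
  have e1 : K0 M = 0 → (K1 M = 0 ↔ Q'.coeff (N - 1) = 0) := by
    intro h
    rw [d3, ← hK0, h, ← Int.cast_eq_zero (α := ℚ), hK1]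
    simp
  constructor
  · rintro ⟨Q1, R1, hQ1, hR1, heq, hdeg⟩
    have hpoly : R1 * R' = Q1 * Q' := by
      apply Polynomial.coe_injective ℚ
      rw [Polynomial.coe_mul, Polynomial.coe_mul, ← hkey, ← heq]; ring
    have hd := congrArg Polynomial.natDegree hpoly
    rw [Polynomial.natDegree_mul hR1 hRm.ne_zero, Polynomial.natDegree_mul hQ1 hQ0, hRd] at hd
    have k0 : K0 M = 0 := e0.2 (Polynomial.coeff_eq_zero_of_natDegree_lt (by omega))
    exact ⟨k0, (e1 k0).2 (Polynomial.coeff_eq_zero_of_natDegree_lt (by omega))⟩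
  · rintro ⟨k0, k1⟩
    refine ⟨R', Q', hRm.ne_zero, hQ0, by rw [mul_comm]; exact hkey, ?_⟩
    have c0 := e0.1 k0
    have c1 := (e1 k0).1 k1
    have hl : Q'.coeff Q'.natDegree ≠ 0 := by
      rw [Polynomial.coeff_natDegree]; exact Polynomial.leadingCoeff_ne_zero.2 hQ0
    have n0 : Q'.natDegree ≠ N := fun h => hl (by rw [h]; exact c0)
    have n1 : Q'.natDegree ≠ N - 1 := fun h => hl (by rw [h]; exact c1)
    omega
end Main

/-- for a generalized Cartan matrix `A` with infinite Weyl group and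
connected Coxeter graph, `deg P(A) ≥ 2` (i.e. the Chapavalov–Leites–Stekolshchik
conjecture fails for `A`) if and only if `K₀(A) = 0` and `K₁(A) = 0`. -/
theorem CLS_conjecture_fails_iff {n : ℕ} (A : Matrix (Fin n) (Fin n) ℤ) (hA : IsGCM A)
    (hinf : Infinite (gcmCoxeter A).Group)
    (hconn : (coxeterGraph (gcmCoxeter A)).Connected) :
    (∃ Q R : Polynomial ℚ, Q ≠ 0 ∧ R ≠ 0 ∧
        (R : PowerSeries ℚ) * coxPoincareQ (gcmCoxeter A) = (Q : PowerSeries ℚ) ∧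
        R.natDegree + 2 ≤ Q.natDegree) ↔
      (K0 (gcmCoxeter A) = 0 ∧ K1 (gcmCoxeter A) = 0) := by
  have _ := hconn
  set M := gcmCoxeter A with hM
  have hinj := gcm_simple_inj A hA
  rw [← hM] at hinj
  exact main_aux M hinj hinf
end

section
/- Let A be an n×n generalized Cartan matrix whose Weyl group W(A) is infinite and whose Coxeter graph is connected. (1) If K_0(A) ≠ 0, then deg P(A) = 0, and for any nonzero polynomials Q, R ∈ ℚ[t] with R·P(A) = Q in ℚ⟦t⟧, the leading coefficient of R equals K_0(A) times the leading coefficient of Q. (2) If K_0(A) = 0 and K_1(A) ≠ 0, then deg P(A) = 1, and for any such Q, R, the leading coefficient of R equals K_1(A) times the leading coefficient of Q. -/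
open PowerSeries

open scoped Classical

namespace CoxAux

section Exchange
variable {B W : Type*} [Group W] {M : CoxeterMatrix B} (cs : CoxeterSystem M W)

lemma endMul {α : Type*} (f g : Function.End α) (p : α) : (f * g) p = f (g p) := rfl

noncomputable def tw (i : B) : Function.End (W × ZMod 2) :=
  fun p => (cs.simple i * p.1 * cs.simple i, p.2 + if p.1 = cs.simple i then 1 else 0)

lemma tw_pow (i j : B) (k : ℕ) (t : W) (e : ZMod 2) :
    ((tw cs i * tw cs j) ^ k : Function.End (W × ZMod 2)) (t, e) =
      ((cs.simple i * cs.simple j) ^ k * t * (cs.simple j * cs.simple i) ^ k,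
        e + ∑ l ∈ Finset.range (2 * k),
          if t = (cs.simple j * cs.simple i) ^ l * cs.simple j then 1 else 0) := by
  induction k with
  | zero => simp [Function.End.one_def]
  | succ k ih =>
    rw [pow_succ', endMul, ih, endMul]
    have hinv : (cs.simple j * cs.simple i)⁻¹ = cs.simple i * cs.simple j := by simp
    set r := cs.simple j * cs.simple i with hr
    have hc : ∀ m : ℕ, cs.simple j * r⁻¹ ^ m = r ^ m * cs.simple j := by
      intro m
      induction m with
      | zero => simp
      | succ m ihm =>
        rw [pow_succ, ← mul_assoc, ihm, pow_succ, hinv, hr]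
        simp [mul_assoc]
    rw [← hinv]
    have e1 : (r⁻¹ ^ k * t * r ^ k = cs.simple j) ↔ t = r ^ (2 * k) * cs.simple j := by
      have h := hc k
      rw [two_mul, pow_add, mul_assoc (r ^ k) (r ^ k), ← h]
      constructor
      · intro h1; rw [← h1]; simp [mul_assoc]
      · rintro rfl; simp [mul_assoc]
    have e2 : (cs.simple j * (r⁻¹ ^ k * t * r ^ k) * cs.simple j = cs.simple i) ↔
        t = r ^ (2 * k + 1) * cs.simple j := by
      have h := hc k
      have h3 : (cs.simple j * (r⁻¹ ^ k * t * r ^ k) * cs.simple j = cs.simple i) ↔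
          r⁻¹ ^ k * t * r ^ k = r * cs.simple j := by
        constructor
        · intro h1
          have h5 : r * cs.simple j = cs.simple j * cs.simple i * cs.simple j := by rw [hr]
          rw [h5, ← h1]
          generalize r⁻¹ ^ k * t * r ^ k = x
          simp [mul_assoc]
        · intro h1; rw [h1, hr]; simp [mul_assoc]
      rw [h3, show 2 * k + 1 = k + 1 + k by ring, pow_add,
        mul_assoc (r ^ (k + 1)) (r ^ k), ← h, pow_succ]
      constructor
      · intro h1
        rw [show r ^ k * r * (cs.simple j * r⁻¹ ^ k) = r ^ k * (r * cs.simple j) * r⁻¹ ^ k by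
          simp only [mul_assoc], ← h1]; simp [mul_assoc]
      · rintro rfl; simp [mul_assoc]
    simp only [tw]
    refine Prod.ext ?_ ?_
    · simp only
      rw [pow_succ' r⁻¹, pow_succ r, hinv, hr]
      simp only [mul_assoc]
    · simp only [e1, e2]
      rw [show 2 * (k + 1) = 2 * k + 1 + 1 by ring, Finset.sum_range_succ, Finset.sum_range_succ]
      ring

lemma tw_liftable : M.IsLiftable (tw cs) := by
  intro i j
  funext p
  obtain ⟨t, e⟩ := p
  rw [tw_pow, Function.End.one_def, id]
  have h1 := cs.simple_mul_simple_pow i j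
  have h2 := cs.simple_mul_simple_pow' i j
  rw [h1, h2, two_mul, Finset.sum_range_add]
  simp only [pow_add, h2, one_mul, mul_one]
  rw [CharTwo.add_self_eq_zero, add_zero]

noncomputable def twHom : W →* Function.End (W × ZMod 2) := cs.lift ⟨tw cs, tw_liftable cs⟩

lemma twHom_simple (i : B) : twHom cs (cs.simple i) = tw cs i := cs.lift_apply_simple _ i

lemma twHom_word (ω : List B) (t : W) (e : ZMod 2) :
    twHom cs (cs.wordProd ω) (t, e) =
      (cs.wordProd ω * t * (cs.wordProd ω)⁻¹, e + ((cs.rightInvSeq ω).count t : ZMod 2)) := by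
  induction ω with
  | nil => simp [Function.End.one_def]
  | cons i ω ih =>
    rw [cs.wordProd_cons, map_mul, endMul, ih, twHom_simple]
    have e1 : (cs.wordProd ω * t * (cs.wordProd ω)⁻¹ = cs.simple i) ↔
       ((cs.wordProd ω)⁻¹ * cs.simple i * cs.wordProd ω = t) := by
      constructor
      · intro h; rw [← h]; simp [mul_assoc]
      · rintro rfl; simp [mul_assoc]
    simp only [tw, CoxeterSystem.rightInvSeq, List.count_cons, e1, beq_iff_eq]
    refine Prod.ext ?_ ?_
    · simp [mul_assoc]
    · push_cast; ring

lemma mem_of_descent (ω : List B) (i : B) (h : cs.IsRightDescent (cs.wordProd ω) i) :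
    cs.simple i ∈ cs.rightInvSeq ω := by
  by_contra hn
  have hc : (cs.rightInvSeq ω).count (cs.simple i) = 0 := List.count_eq_zero_of_not_mem hn
  obtain ⟨ω', hr, hw⟩ := cs.exists_isReduced (cs.wordProd ω * cs.simple i)
  have h1 := twHom_word cs ω (cs.simple i) 1
  have h2 := twHom_word cs ω' (cs.simple i) 0
  rw [← hw, map_mul, endMul, twHom_simple] at h2
  simp only [tw, if_true, zero_add, cs.simple_mul_simple_self, one_mul] at h2
  rw [h1] at h2
  have h3 := congrArg Prod.snd h2
  simp only [hc, Nat.cast_zero, add_zero] at h3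
  have h4 : cs.simple i ∈ cs.rightInvSeq ω' := by
    by_contra hn'
    rw [List.count_eq_zero_of_not_mem hn'] at h3
    simp at h3
  have h5 := (cs.isRightInversion_of_mem_rightInvSeq hr h4).2
  rw [← hw] at h5
  simp only [cs.simple_mul_simple_cancel_right] at h5
  unfold CoxeterSystem.IsRightDescent at h
  omega

theorem exchange (ω : List B) (i : B) (h : cs.IsRightDescent (cs.wordProd ω) i) :
    ∃ j < ω.length, cs.wordProd ω * cs.simple i = cs.wordProd (ω.eraseIdx j) := by
  obtain ⟨j, hj, hij⟩ := List.mem_iff_getElem.mp (mem_of_descent cs ω i h)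
  refine ⟨j, by simpa using hj, ?_⟩
  rw [← cs.wordProd_mul_getD_rightInvSeq, List.getD_eq_getElem _ 1 hj, hij]

end Exchange

section Parabolic
variable {n : ℕ} (M : CoxeterMatrix (Fin n))

lemma word_mem {I : Finset (Fin n)} (ω : List (Fin n)) (h : ∀ i ∈ ω, i ∈ I) :
    M.toCoxeterSystem.wordProd ω ∈ coxParabolic M I := by
  induction ω with
  | nil => simp [one_mem]
  | cons i ω ih =>
    rw [CoxeterSystem.wordProd_cons]
    refine mul_mem (Subgroup.subset_closure ⟨i, ?_, rfl⟩) (ih fun j hj => h j (by simp [hj]))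
    exact_mod_cast h i (by simp)

lemma exists_word {I : Finset (Fin n)} {w : M.Group} (hw : w ∈ coxParabolic M I) :
    ∃ ω : List (Fin n), (∀ i ∈ ω, i ∈ I) ∧ w = M.toCoxeterSystem.wordProd ω := by
  unfold coxParabolic at hw
  induction hw using Subgroup.closure_induction with
  | mem x hx =>
    obtain ⟨i, hi, rfl⟩ := hx
    exact ⟨[i], by simpa using hi, by simp⟩
  | one => exact ⟨[], by simp, by simp⟩
  | mul x y _ _ hx hy =>
    obtain ⟨a, ha, rfl⟩ := hx
    obtain ⟨b, hb, rfl⟩ := hy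
    refine ⟨a ++ b, ?_, by rw [CoxeterSystem.wordProd_append]⟩
    intro i hi
    rcases List.mem_append.mp hi with h | h
    · exact ha i h
    · exact hb i h
  | inv x _ hx =>
    obtain ⟨a, ha, rfl⟩ := hx
    exact ⟨a.reverse, by simpa using ha, by simp⟩

lemma exists_reduced {I : Finset (Fin n)} {w : M.Group} (hw : w ∈ coxParabolic M I) :
    ∃ ω : List (Fin n), (∀ i ∈ ω, i ∈ I) ∧ M.toCoxeterSystem.IsReduced ω ∧
      w = M.toCoxeterSystem.wordProd ω := by
  obtain ⟨ω, h, rfl⟩ := exists_word M hw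
  clear hw
  induction ω using List.reverseRecOn with
  | nil => exact ⟨[], by simp, by simp [CoxeterSystem.IsReduced], rfl⟩
  | append_singleton ω i ih =>
    obtain ⟨α, hα, hr, he⟩ := ih fun j hj => h j (by simp [hj])
    have hi : i ∈ I := h i (by simp)
    rw [CoxeterSystem.wordProd_append, he, CoxeterSystem.wordProd_singleton]
    rcases M.toCoxeterSystem.length_mul_simple (M.toCoxeterSystem.wordProd α) i with h1 | h1
    · refine ⟨α ++ [i], ?_, ?_, by simp [CoxeterSystem.wordProd_append]⟩
      · intro j hj
        rcases List.mem_append.mp hj with h | h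
        · exact hα j h
        · simp at h; exact h ▸ hi
      · unfold CoxeterSystem.IsReduced at *
        rw [CoxeterSystem.wordProd_append, CoxeterSystem.wordProd_singleton, h1, hr]; simp
    · obtain ⟨j, hj, hx⟩ := exchange M.toCoxeterSystem α i (by
        unfold CoxeterSystem.IsRightDescent; omega)
      refine ⟨α.eraseIdx j, fun k hk => hα k (List.mem_of_mem_eraseIdx hk), ?_, hx⟩
      unfold CoxeterSystem.IsReduced at *
      rw [← hx]
      have := List.length_eraseIdx_add_one hj
      omega

lemma reduced_init {ω : List (Fin n)} {i : Fin n}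
    (h : M.toCoxeterSystem.IsReduced (ω ++ [i])) : M.toCoxeterSystem.IsReduced ω := by
  have := h.take ω.length
  simpa using this

lemma coset_add_word {J : Finset (Fin n)} {u : M.Group}
    (hu : ∀ v ∈ coxParabolic M J, M.toCoxeterSystem.length u ≤ M.toCoxeterSystem.length (u * v))
    (ω : List (Fin n)) (hω : ∀ i ∈ ω, i ∈ J) (hr : M.toCoxeterSystem.IsReduced ω) :
    M.toCoxeterSystem.length (u * M.toCoxeterSystem.wordProd ω) =
      M.toCoxeterSystem.length u + ω.length := by
  induction ω using List.reverseRecOn with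
  | nil => simp
  | append_singleton ω i ih =>
    have hω' : ∀ j ∈ ω, j ∈ J := fun j hj => hω j (by simp [hj])
    have ih' := ih hω' (reduced_init M hr)
    rw [CoxeterSystem.wordProd_append, CoxeterSystem.wordProd_singleton, ← mul_assoc]
    rcases M.toCoxeterSystem.length_mul_simple (u * M.toCoxeterSystem.wordProd ω) i with h1 | h1
    · rw [h1, ih']; simp [add_assoc]
    · exfalso
      obtain ⟨α, hα, rfl⟩ := M.toCoxeterSystem.exists_isReduced u
      rw [← CoxeterSystem.wordProd_append] at h1
      obtain ⟨j, hj, hx⟩ := exchange M.toCoxeterSystem (α ++ ω) i (by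
        unfold CoxeterSystem.IsRightDescent; omega)
      by_cases hjα : j < α.length
      · rw [List.eraseIdx_append_of_lt_length hjα, CoxeterSystem.wordProd_append,
          CoxeterSystem.wordProd_append] at hx
        have hm : M.toCoxeterSystem.wordProd ω * M.toCoxeterSystem.simple i *
            (M.toCoxeterSystem.wordProd ω)⁻¹ ∈ coxParabolic M J := by
          refine mul_mem (mul_mem (word_mem M ω hω') ?_) (inv_mem (word_mem M ω hω'))
          simpa using word_mem M [i] (by simpa using hω i (by simp))
        have h2 := hu _ hm
        rw [← mul_assoc, ← mul_assoc, hx] at h2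
        simp only [mul_inv_cancel_right] at h2
        have h3 := M.toCoxeterSystem.length_wordProd_le (α.eraseIdx j)
        have := List.length_eraseIdx_add_one hjα
        unfold CoxeterSystem.IsReduced at hα
        omega
      · push Not at hjα
        rw [List.eraseIdx_append_of_length_le hjα, CoxeterSystem.wordProd_append,
          CoxeterSystem.wordProd_append, mul_assoc] at hx
        have hx := mul_left_cancel hx
        unfold CoxeterSystem.IsReduced at hr
        rw [CoxeterSystem.wordProd_append, CoxeterSystem.wordProd_singleton, hx] at hr
        have h3 := M.toCoxeterSystem.length_wordProd_le (ω.eraseIdx (j - α.length))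
        have := List.length_eraseIdx_le ω (j - α.length)
        simp at hr
        omega

lemma coset_add {J : Finset (Fin n)} {u : M.Group}
    (hu : ∀ v ∈ coxParabolic M J, M.toCoxeterSystem.length u ≤ M.toCoxeterSystem.length (u * v))
    {v : M.Group} (hv : v ∈ coxParabolic M J) :
    M.toCoxeterSystem.length (u * v) =
      M.toCoxeterSystem.length u + M.toCoxeterSystem.length v := by
  obtain ⟨ω, h1, h2, rfl⟩ := exists_reduced M hv
  rw [coset_add_word M hu ω h1 h2, h2.eq]

lemma max_word {I : Finset (Fin n)} {u : M.Group}
    (hu : ∀ i ∈ I, M.toCoxeterSystem.IsRightDescent u i)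
    (ω : List (Fin n)) (hω : ∀ i ∈ ω, i ∈ I) (hr : M.toCoxeterSystem.IsReduced ω) :
    ∃ x, u = x * M.toCoxeterSystem.wordProd ω ∧
      M.toCoxeterSystem.length u = M.toCoxeterSystem.length x + ω.length := by
  induction ω using List.reverseRecOn with
  | nil => exact ⟨u, by simp⟩
  | append_singleton ω i ih =>
    obtain ⟨x, hx, hl⟩ := ih (fun j hj => hω j (by simp [hj])) (reduced_init M hr)
    have hd := hu i (hω i (by simp))
    obtain ⟨α, hα, rfl⟩ := M.toCoxeterSystem.exists_isReduced x
    have hx' := hx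
    rw [← CoxeterSystem.wordProd_append] at hx
    rw [hx] at hd
    obtain ⟨j, hj, hy⟩ := exchange M.toCoxeterSystem _ i hd
    by_cases hjα : j < α.length
    · rw [List.eraseIdx_append_of_lt_length hjα, ← hx,
        CoxeterSystem.wordProd_append] at hy
      have hu' : u = M.toCoxeterSystem.wordProd (α.eraseIdx j) *
          M.toCoxeterSystem.wordProd (ω ++ [i]) := by
        rw [CoxeterSystem.wordProd_append, ← mul_assoc, ← hy, CoxeterSystem.wordProd_singleton,
          CoxeterSystem.simple_mul_simple_cancel_right]
      refine ⟨_, hu', ?_⟩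
      have h1 := M.toCoxeterSystem.length_mul_le (M.toCoxeterSystem.wordProd (α.eraseIdx j))
        (M.toCoxeterSystem.wordProd (ω ++ [i]))
      rw [← hu', hr.eq] at h1
      have h2 := M.toCoxeterSystem.length_wordProd_le (α.eraseIdx j)
      have := List.length_eraseIdx_add_one hjα
      unfold CoxeterSystem.IsReduced at hα
      simp at *
      omega
    · exfalso
      push Not at hjα
      rw [List.eraseIdx_append_of_length_le hjα, CoxeterSystem.wordProd_append,
          CoxeterSystem.wordProd_append, mul_assoc] at hy
      have hx := mul_left_cancel hy
      unfold CoxeterSystem.IsReduced at hr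
      rw [CoxeterSystem.wordProd_append, CoxeterSystem.wordProd_singleton, hx] at hr
      have h3 := M.toCoxeterSystem.length_wordProd_le (ω.eraseIdx (j - α.length))
      have := List.length_eraseIdx_le ω (j - α.length)
      simp at hr
      omega

lemma finite_level (k : ℕ) : {w : M.Group | M.toCoxeterSystem.length w = k}.Finite := by
  refine ((List.finite_length_eq (Fin n) k).image M.toCoxeterSystem.wordProd).subset ?_
  intro w hw
  obtain ⟨ω, hω, rfl⟩ := M.toCoxeterSystem.exists_isReduced w
  exact ⟨ω, by rw [Set.mem_ofPred_eq, ← hω.eq]; exact hw, rfl⟩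

lemma finite_of_max {I : Finset (Fin n)} {u : M.Group}
    (hu : ∀ i ∈ I, M.toCoxeterSystem.IsRightDescent u i) : Finite (coxParabolic M I) := by
  have : ((⋃ k ∈ Finset.range (M.toCoxeterSystem.length u + 1),
      {w : M.Group | M.toCoxeterSystem.length w = k})).Finite :=
    Set.Finite.biUnion (Finset.finite_toSet _) (fun k _ => finite_level M k)
  refine (this.subset ?_ : (coxParabolic M I : Set M.Group).Finite)
  intro w hw
  obtain ⟨ω, h1, h2, rfl⟩ := exists_reduced M hw
  obtain ⟨x, hx, hl⟩ := max_word M hu ω h1 h2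
  have := h2.eq
  simp only [Set.mem_iUnion, Finset.mem_range, Set.mem_ofPred_eq]
  exact ⟨_, by omega, rfl⟩

def noDesc (J : Finset (Fin n)) (u : M.Group) : Prop :=
  ∀ j ∈ J, ¬ M.toCoxeterSystem.IsRightDescent u j

lemma exists_min (J : Finset (Fin n)) (w : M.Group) :
    ∃ v ∈ coxParabolic M J, ∀ v' ∈ coxParabolic M J,
      M.toCoxeterSystem.length (w * v) ≤ M.toCoxeterSystem.length (w * v * v') := by
  let S : Set M.Group := {v | v ∈ coxParabolic M J}
  have hS : S.Nonempty := ⟨1, (one_mem (coxParabolic M J) :)⟩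
  obtain ⟨v, hv, hmin⟩ := WellFounded.wellFounded_iff_has_min.mp
    (InvImage.wf (fun v => M.toCoxeterSystem.length (w * v)) (Nat.lt_wfRel.wf)) S hS
  refine ⟨v, hv, fun v' hv' => ?_⟩
  have := hmin (v * v') (mul_mem hv hv')
  rw [mul_assoc]
  exact not_lt.mp this

lemma min_of_noDesc {J : Finset (Fin n)} {u : M.Group} (h : noDesc M J u) :
    ∀ v ∈ coxParabolic M J, M.toCoxeterSystem.length u ≤ M.toCoxeterSystem.length (u * v) := by
  obtain ⟨v, hv, hmin⟩ := exists_min M J u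
  have key : v = 1 := by
    obtain ⟨ω, h1, h2, h3⟩ := exists_reduced M (inv_mem hv)
    rcases List.eq_nil_or_concat ω with rfl | ⟨α, i, rfl⟩
    · simpa using h3
    · exfalso
      have hi : i ∈ J := h1 i (by simp)
      apply h i hi
      have hs : M.toCoxeterSystem.simple i ∈ coxParabolic M J := by
        simpa using word_mem M [i] (by simpa using hi)
      have e1 := coset_add M hmin (inv_mem hv)
      have e2 := coset_add M hmin (mul_mem (inv_mem hv) hs)
      rw [← mul_assoc] at e2
      simp only [mul_inv_cancel_right] at e1 e2
      unfold CoxeterSystem.IsRightDescent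
      rw [e2, e1]
      have e3 : M.toCoxeterSystem.length (v⁻¹ * M.toCoxeterSystem.simple i) ≤ α.length := by
        rw [h3, CoxeterSystem.wordProd_concat, CoxeterSystem.simple_mul_simple_cancel_right]
        exact M.toCoxeterSystem.length_wordProd_le _
      have e4 := h2.eq
      rw [← h3] at e4
      simp at e4 e3
      simp
      omega
  subst key
  simpa using hmin

lemma exists_decomp (J : Finset (Fin n)) (w : M.Group) :
    ∃ u v, noDesc M J u ∧ v ∈ coxParabolic M J ∧ w = u * v := by
  obtain ⟨v, hv, hmin⟩ := exists_min M J w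
  refine ⟨w * v, v⁻¹, ?_, inv_mem hv, by simp⟩
  intro j hj hd
  have := hmin (M.toCoxeterSystem.simple j) (by
    simpa using word_mem M [j] (by simpa using hj))
  unfold CoxeterSystem.IsRightDescent at hd
  omega

lemma decomp_unique {J : Finset (Fin n)} {u v u' v' : M.Group} (hu : noDesc M J u)
    (hu' : noDesc M J u') (hv : v ∈ coxParabolic M J) (hv' : v' ∈ coxParabolic M J)
    (h : u * v = u' * v') : u = u' ∧ v = v' := by
  have hx : v * v'⁻¹ ∈ coxParabolic M J := mul_mem hv (inv_mem hv')
  have e1 := coset_add M (min_of_noDesc M hu) hx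
  have e2 := coset_add M (min_of_noDesc M hu') (inv_mem hx)
  have e3 : u * (v * v'⁻¹) = u' := by rw [← mul_assoc, h]; simp
  have e4 : u' * (v * v'⁻¹)⁻¹ = u := by rw [← e3, mul_inv_cancel_right]
  rw [e3] at e1
  rw [e4] at e2
  have : v * v'⁻¹ = 1 := by
    rw [← M.toCoxeterSystem.length_eq_zero_iff]; omega
  have hvv : v = v' := by simpa [mul_inv_eq_one] using this
  subst hvv
  exact ⟨mul_right_cancel h, rfl⟩

noncomputable def lev (k : ℕ) : Finset M.Group := (finite_level M k).toFinset

lemma mem_lev {k : ℕ} {w : M.Group} : w ∈ lev M k ↔ M.toCoxeterSystem.length w = k := by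
  simp [lev]

noncomputable def Pser (I : Finset (Fin n)) : PowerSeries ℚ :=
  PowerSeries.mk fun k => (((lev M k).filter (fun w => w ∈ coxParabolic M I)).card : ℚ)

noncomputable def Qser (I J : Finset (Fin n)) : PowerSeries ℚ :=
  PowerSeries.mk fun k =>
    (((lev M k).filter (fun w => w ∈ coxParabolic M I ∧ noDesc M J w)).card : ℚ)

lemma par_mono {I J : Finset (Fin n)} (h : J ⊆ I) : coxParabolic M J ≤ coxParabolic M I :=
  Subgroup.closure_mono (Set.image_mono (by exact_mod_cast h))

lemma Pser_eq {I J : Finset (Fin n)} (hJ : J ⊆ I) : Pser M I = Qser M I J * Pser M J := by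
  ext k
  rw [PowerSeries.coeff_mul]
  simp only [Pser, Qser, PowerSeries.coeff_mk]
  norm_cast
  simp only [← Finset.card_product]
  rw [← Finset.card_sigma]
  symm
  refine Finset.card_bij (fun x _ => x.2.1 * x.2.2) ?_ ?_ ?_
  · rintro ⟨⟨p, q⟩, ⟨u, v⟩⟩ hx
    simp only [Finset.mem_sigma, Finset.HasAntidiagonal.mem_antidiagonal, Finset.mem_product, Finset.mem_filter,
      mem_lev] at hx ⊢
    obtain ⟨hk, ⟨hp, huI, hud⟩, hq, hv⟩ := hx
    refine ⟨?_, mul_mem huI (par_mono M hJ hv)⟩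
    rw [coset_add M (min_of_noDesc M hud) hv]; omega
  · rintro ⟨⟨p, q⟩, ⟨u, v⟩⟩ hx ⟨⟨p', q'⟩, ⟨u', v'⟩⟩ hx' he
    simp only [Finset.mem_sigma, Finset.HasAntidiagonal.mem_antidiagonal, Finset.mem_product, Finset.mem_filter,
      mem_lev] at hx hx' he
    obtain ⟨hk, ⟨rfl, huI, hud⟩, rfl, hv⟩ := hx
    obtain ⟨hk', ⟨rfl, huI', hud'⟩, rfl, hv'⟩ := hx'
    obtain ⟨rfl, rfl⟩ := decomp_unique M hud hud' hv hv' he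
    rfl
  · intro w hw
    simp only [Finset.mem_filter, mem_lev] at hw
    obtain ⟨u, v, hu, hv, rfl⟩ := exists_decomp M J w
    refine ⟨⟨(M.toCoxeterSystem.length u, M.toCoxeterSystem.length v), (u, v)⟩, ?_, rfl⟩
    simp only [Finset.mem_sigma, Finset.HasAntidiagonal.mem_antidiagonal, Finset.mem_product, Finset.mem_filter,
      mem_lev]
    refine ⟨?_, ⟨trivial, ?_, hu⟩, trivial, hv⟩
    · rw [← coset_add M (min_of_noDesc M hu) hv]; exact hw.1
    · have := mul_mem hw.2 (inv_mem (par_mono M hJ hv))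
      simpa using this

lemma sum_Qser {I : Finset (Fin n)} (hI : Infinite (coxParabolic M I)) :
    ∑ J ∈ I.powerset, (-1 : PowerSeries ℚ) ^ J.card * Qser M I J = 0 := by
  ext k
  rw [map_sum, map_zero]
  have h1 : ∀ J : Finset (Fin n), (PowerSeries.coeff k) ((-1 : PowerSeries ℚ) ^ J.card * Qser M I J) =
      ∑ w ∈ (lev M k).filter (fun w => w ∈ coxParabolic M I),
        if noDesc M J w then (-1 : ℚ) ^ J.card else 0 := by
    intro J
    have : (-1 : PowerSeries ℚ) ^ J.card = PowerSeries.C ((-1 : ℚ) ^ J.card) := by simp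
    rw [this, PowerSeries.coeff_C_mul, ← Finset.sum_filter, Finset.filter_filter, Finset.sum_const,
      Qser, PowerSeries.coeff_mk, nsmul_eq_mul, mul_comm]
  simp only [h1]
  rw [Finset.sum_comm]
  refine Finset.sum_eq_zero fun w hw => ?_
  rw [← Finset.sum_filter]
  have h2 : I.powerset.filter (fun J => noDesc M J w) =
      (I.filter (fun i => ¬ M.toCoxeterSystem.IsRightDescent w i)).powerset := by
    ext J
    simp only [Finset.mem_filter, Finset.mem_powerset, Finset.subset_iff]
    unfold noDesc
    constructor
    · rintro ⟨a, b⟩ x hx; exact ⟨a hx, b x hx⟩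
    · intro a; exact ⟨fun x hx => (a hx).1, fun x hx => (a hx).2⟩
  rw [h2]
  have h3 := Finset.sum_powerset_neg_one_pow_card_of_nonempty
    (x := I.filter (fun i => ¬ M.toCoxeterSystem.IsRightDescent w i)) (by
      by_contra hne
      rw [Finset.not_nonempty_iff_eq_empty, Finset.filter_eq_empty_iff] at hne
      have := finite_of_max M (I := I) (u := w) (fun i hi => not_not.mp (hne hi))
      exact hI.not_finite this)
  exact_mod_cast h3

end Parabolic

section Chains
variable {n : ℕ} (inf lst : Finset (Fin n) → Prop)

noncomputable def G (r : ℕ) (I : Finset (Fin n)) : ℤ :=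
  ∑ c : Fin (r + 1) → Finset (Fin n),
    if c 0 = I ∧ StrictAnti c ∧ (∀ j : Fin r, inf (c j.castSucc)) ∧ lst (c (Fin.last r)) then
      (-1 : ℤ) ^ r else 0

lemma G_zero (I : Finset (Fin n)) : G inf lst 0 I = if lst I then 1 else 0 := by
  unfold G
  rw [Fintype.sum_eq_single (fun _ => I)]
  · have : StrictAnti (fun _ : Fin 1 => I) := fun a b h => by
      exfalso; omega
    simp [this]
  · intro c hc
    rw [if_neg]
    rintro ⟨h, -⟩
    apply hc
    funext j
    rw [← h]; congr 1; omega

lemma G_succ (r : ℕ) (I : Finset (Fin n)) :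
    G inf lst (r + 1) I = if inf I then - ∑ J ∈ I.ssubsets, G inf lst r J else 0 := by
  unfold G
  let E := Fin.consEquiv (fun _ : Fin (r + 2) => Finset (Fin n))
  rw [← E.sum_comp, Fintype.sum_prod_type]
  have key : ∀ (a : Finset (Fin n)) (d : Fin (r + 1) → Finset (Fin n)),
      ((E (a, d)) 0 = I ∧
        StrictAnti (E (a, d)) ∧
        (∀ j : Fin (r + 1), inf ((E (a, d)) j.castSucc)) ∧
        lst ((E (a, d)) (Fin.last (r + 1)))) ↔
      a = I ∧ inf a ∧ d 0 ∈ a.ssubsets ∧ (StrictAnti d ∧ (∀ j : Fin r, inf (d j.castSucc)) ∧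
        lst (d (Fin.last r))) := by
    intro a d
    have hE : E (a, d) = (Fin.cons a d : Fin (r + 2) → Finset (Fin n)) := rfl
    rw [hE]
    have h1 : StrictAnti (Fin.cons a d : Fin (r + 2) → Finset (Fin n)) ↔ d 0 < a ∧ StrictAnti d :=
      strictAnti_vecCons
    rw [h1, Fin.forall_fin_succ, ← Fin.succ_last, Fin.cons_succ, Fin.cons_zero, Fin.castSucc_zero,
      Fin.cons_zero]
    simp only [Fin.castSucc_succ, Fin.cons_succ, Finset.mem_ssubsets]
    tauto
  simp only [key]
  rw [Fintype.sum_eq_single I]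
  · rw [Finset.sum_comm]
    by_cases hI : inf I
    · rw [if_pos hI, ← Finset.sum_neg_distrib]
      refine Finset.sum_congr rfl fun d _ => ?_
      by_cases hd : StrictAnti d ∧ (∀ j : Fin r, inf (d j.castSucc)) ∧ lst (d (Fin.last r))
      · simp only [hI, hd, and_true, true_and, implies_true]
        rw [Finset.sum_ite_eq]
        split_ifs
        · ring
        · simp
      · rw [if_neg (fun h => hd h.2.2.2), Finset.sum_eq_zero, neg_zero]
        intro J _
        rw [if_neg (fun h => hd h.2)]
    · rw [if_neg hI]
      refine Finset.sum_eq_zero fun d _ => ?_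
      rw [if_neg (fun h => hI h.2.1)]
  · intro a ha
    refine Finset.sum_eq_zero fun d _ => ?_
    rw [if_neg (fun h => ha h.1)]

lemma G_vanish (hl : ¬ lst ∅) (r : ℕ) (I : Finset (Fin n)) (h : I.card ≤ r) :
    G inf lst r I = 0 := by
  induction r generalizing I with
  | zero =>
    have : I = ∅ := by simpa using h
    subst this
    simp [G_zero, hl]
  | succ r ih =>
    rw [G_succ, Finset.sum_eq_zero, neg_zero, ite_self]
    intro J hJ
    apply ih
    have := Finset.card_lt_card (Finset.mem_ssubsets.mp hJ)
    omega

noncomputable def U (I : Finset (Fin n)) : ℤ := ∑ r ∈ Finset.range n, G inf lst r I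

lemma U_rec (hl : ¬ lst ∅) (I : Finset (Fin n)) :
    U inf lst I = (if lst I then 1 else 0) -
      if inf I then ∑ J ∈ I.ssubsets, U inf lst J else 0 := by
  have h1 : U inf lst I = ∑ r ∈ Finset.range (n + 1), G inf lst r I := by
    rw [Finset.sum_range_succ, G_vanish inf lst hl n I (by simpa using Finset.card_le_univ I),
      add_zero, U]
  rw [h1, Finset.sum_range_succ', G_zero]
  simp only [G_succ, U]
  split_ifs
  all_goals first | (rw [Finset.sum_comm]; simp; try ring) | simp

end Chains

section K
variable {n : ℕ} (M : CoxeterMatrix (Fin n))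

def infI (I : Finset (Fin n)) : Prop := Infinite (coxParabolic M I)
def oneI (I : Finset (Fin n)) : Prop := I.card = 1

lemma not_infI_empty : ¬ infI M ∅ := by
  unfold infI coxParabolic
  rw [not_infinite_iff_finite]
  simp only [Finset.coe_empty, Set.image_empty, Subgroup.closure_empty]
  infer_instance

lemma K0_eq : K0 M = (-1) ^ (n + 1) * U (infI M) (infI M) Finset.univ := by
  unfold K0 U G
  rw [Finset.mul_sum]
  refine Finset.sum_congr rfl fun r _ => ?_
  rw [Finset.mul_sum]
  refine Finset.sum_congr rfl fun c _ => ?_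
  have : (IsGCMChain c ∧ ∀ j, Infinite (coxParabolic M (c j))) ↔
      (c 0 = Finset.univ ∧ StrictAnti c ∧ (∀ j : Fin r, infI M (c j.castSucc)) ∧
        infI M (c (Fin.last r))) := by
    unfold IsGCMChain
    constructor
    · rintro ⟨⟨a, b, d⟩, e⟩
      exact ⟨a, b, fun j => e _, e _⟩
    · rintro ⟨a, b, d, e⟩
      refine ⟨⟨a, b, fun h => not_infI_empty M (h ▸ e)⟩, fun j => ?_⟩
      induction j using Fin.lastCases with
      | last => exact e
      | cast j => exact d j
  simp only [this]
  rw [mul_ite, mul_zero, ← pow_add, show n + 1 + r = n + r + 1 by ring]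

lemma K1_eq : K1 M = (-1) ^ (n + 1) * U (infI M) (oneI) Finset.univ := by
  unfold K1 U G
  rw [Finset.mul_sum]
  refine Finset.sum_congr rfl fun r _ => ?_
  rw [Finset.mul_sum]
  refine Finset.sum_congr rfl fun c _ => ?_
  have : (IsGCMChain c ∧ (∀ j : Fin r, Infinite (coxParabolic M (c j.castSucc))) ∧
        (c (Fin.last r)).card = 1) ↔
      (c 0 = Finset.univ ∧ StrictAnti c ∧ (∀ j : Fin r, infI M (c j.castSucc)) ∧
        oneI (c (Fin.last r))) := by
    unfold IsGCMChain oneI infI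
    constructor
    · rintro ⟨⟨a, b, d⟩, e⟩
      exact ⟨a, b, e⟩
    · rintro ⟨a, b, d, e⟩
      refine ⟨⟨a, b, fun h => ?_⟩, d, e⟩
      rw [h] at e; simp at e
  simp only [this]
  rw [mul_ite, mul_zero, ← pow_add, show n + 1 + r = n + r + 1 by ring]

end K

section Rep
variable {n : ℕ} (A : Matrix (Fin n) (Fin n) ℤ)

def Lf (i : Fin n) (v : Fin n → ℤ) : ℤ := ∑ k, A i k * v k

def rf (i : Fin n) : Function.End (Fin n → ℤ) := fun v => v - Pi.single i (Lf A i v)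

lemma Lf_add (i : Fin n) (v w : Fin n → ℤ) : Lf A i (v + w) = Lf A i v + Lf A i w := by
  simp [Lf, mul_add, Finset.sum_add_distrib]

lemma Lf_single (i j : Fin n) (c : ℤ) : Lf A i (Pi.single j c) = A i j * c := by
  simp [Lf, Pi.single_apply]

def st (a b x y : ℤ) (p : ℤ × ℤ) : ℤ × ℤ :=
  (-p.1 - x - a * (-p.2 - y - b * p.1), -p.2 - y - b * p.1)

lemma rf_pow (hA : IsGCM A) (i j : Fin n) (v : Fin n → ℤ) (k : ℕ) :
    ((rf A i * rf A j) ^ k : Function.End (Fin n → ℤ)) v =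
      v + Pi.single i ((st (A i j) (A j i) (Lf A i v) (Lf A j v))^[k] (0, 0)).1 +
        Pi.single j ((st (A i j) (A j i) (Lf A i v) (Lf A j v))^[k] (0, 0)).2 := by
  induction k with
  | zero => simp [Function.End.one_def]
  | succ k ih =>
    rw [pow_succ', endMul, ih, endMul, Function.iterate_succ_apply']
    generalize (st (A i j) (A j i) (Lf A i v) (Lf A j v))^[k] (0, 0) = p
    have h1 : rf A j (v + Pi.single i p.1 + Pi.single j p.2) =
        v + Pi.single i p.1 + Pi.single j (-p.2 - Lf A j v - A j i * p.1) := by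
      unfold rf
      simp only [Lf_add, Lf_single, hA.diag]
      rw [add_sub_assoc, ← Pi.single_sub]
      congr 2; ring
    rw [h1]
    unfold rf st
    simp only [Lf_add, Lf_single, hA.diag]
    rw [add_right_comm, add_sub_assoc, ← Pi.single_sub, add_right_comm]
    congr 3; ring

lemma rf_liftable (hA : IsGCM A) : (gcmCoxeter A).IsLiftable (rf A) := by
  intro i j
  funext v
  have hM : (gcmCoxeter A) i j = if i = j then 1 else gcmEntry (A i j * A j i) := rfl
  rw [rf_pow A hA, hM]
  change _ = v
  split_ifs with h
  · subst h
    rw [add_assoc, ← Pi.single_add]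
    simp [st, hA.diag]
    ring
  · suffices h0 : (st (A i j) (A j i) (Lf A i v) (Lf A j v))^[gcmEntry (A i j * A j i)] (0, 0)
        = (0, 0) by
      rw [h0]; simp
    generalize Lf A i v = x
    generalize Lf A j v = y
    have ha := hA.nonpos i j h
    have hb := hA.nonpos j i (Ne.symm h)
    have hz := hA.zero_symm i j
    have hz' := hA.zero_symm j i
    generalize A i j = a at *
    generalize A j i = b at *
    unfold gcmEntry
    have hfac : a * b = 0 ∨ a * b = 1 ∨ a * b = 2 ∨ a * b = 3 ∨
      (a * b ≠ 0 ∧ a * b ≠ 1 ∧ a * b ≠ 2 ∧ a * b ≠ 3) := by tauto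
    have bd : a * b ≠ 0 → a * b ≤ 3 → -3 ≤ a ∧ -3 ≤ b := by
      intro h1 h2
      have ha' : a ≤ -1 := by
        have : a ≠ 0 := fun h => h1 (by simp [h])
        omega
      have hb' : b ≤ -1 := by
        have : b ≠ 0 := fun h => h1 (by simp [h])
        omega
      constructor <;> nlinarith
    rcases hfac with h0 | h0 | h0 | h0 | h0
    · have : a = 0 ∧ b = 0 := by
        rcases mul_eq_zero.mp h0 with h | h
        · exact ⟨h, hz h⟩
        · exact ⟨hz' h, h⟩
      obtain ⟨rfl, rfl⟩ := this
      simp [st]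
    · obtain ⟨h3, h4⟩ := bd (by omega) (by omega)
      interval_cases a <;> interval_cases b <;> first | omega | skip
      simp [st]
    · obtain ⟨h3, h4⟩ := bd (by omega) (by omega)
      interval_cases a <;> interval_cases b <;> first | omega | skip
      all_goals simp [st]; try constructor <;> ring
    · obtain ⟨h3, h4⟩ := bd (by omega) (by omega)
      interval_cases a <;> interval_cases b <;> first | omega | skip
      all_goals simp [st]; try constructor <;> ring
    · simp [h0]

lemma simple_ne (hA : IsGCM A) {i j : Fin n} (h : i ≠ j) :
    (gcmCoxeter A).toCoxeterSystem.simple i ≠ (gcmCoxeter A).toCoxeterSystem.simple j := by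
  intro he
  have h1 := congrArg ((gcmCoxeter A).toCoxeterSystem.lift ⟨rf A, rf_liftable A hA⟩) he
  rw [CoxeterSystem.lift_apply_simple, CoxeterSystem.lift_apply_simple] at h1
  have h2 := congrFun (congrFun h1 (Pi.single i 1)) i
  simp [rf, Lf_single, hA.diag, h] at h2

end Rep

section Expansion
open Polynomial

def HasExp (f : PowerSeries ℚ) (a b : ℚ) : Prop :=
  ∃ D N : ℚ[X], D ≠ 0 ∧ (D : PowerSeries ℚ) * f = (N : PowerSeries ℚ) ∧
    (Polynomial.X * N - (Polynomial.C a * Polynomial.X + Polynomial.C b) * D).degree < D.degree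

lemma HasExp.zero : HasExp 0 0 0 := ⟨1, 0, one_ne_zero, by simp, by simp⟩

lemma HasExp.smul {f : PowerSeries ℚ} {a b : ℚ} (h : HasExp f a b) (c : ℚ) :
    HasExp (PowerSeries.C c * f) (c * a) (c * b) := by
  obtain ⟨D, N, hD, he, hd⟩ := h
  refine ⟨D, Polynomial.C c * N, hD, ?_, ?_⟩
  · rw [Polynomial.coe_mul, ← he, Polynomial.coe_C]; ring
  · have : Polynomial.X * (Polynomial.C c * N) -
      (Polynomial.C (c * a) * Polynomial.X + Polynomial.C (c * b)) * D =
      Polynomial.C c * (Polynomial.X * N -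
        (Polynomial.C a * Polynomial.X + Polynomial.C b) * D) := by
      simp only [Polynomial.C_mul]; ring
    rw [this, ← Polynomial.smul_eq_C_mul]
    exact (Polynomial.degree_smul_le _ _).trans_lt hd

lemma HasExp.add {f g : PowerSeries ℚ} {a b a' b' : ℚ} (h : HasExp f a b) (h' : HasExp g a' b') :
    HasExp (f + g) (a + a') (b + b') := by
  obtain ⟨D, N, hD, he, hd⟩ := h
  obtain ⟨D', N', hD', he', hd'⟩ := h'
  refine ⟨D * D', D' * N + D * N', mul_ne_zero hD hD', ?_, ?_⟩
  · simp only [Polynomial.coe_mul, Polynomial.coe_add]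
    rw [← he, ← he']; ring
  · have : Polynomial.X * (D' * N + D * N') -
      (Polynomial.C (a + a') * Polynomial.X + Polynomial.C (b + b')) * (D * D') =
      D' * (Polynomial.X * N - (Polynomial.C a * Polynomial.X + Polynomial.C b) * D) +
      D * (Polynomial.X * N' - (Polynomial.C a' * Polynomial.X + Polynomial.C b') * D') := by
      simp only [Polynomial.C_add]; ring
    rw [this]
    refine (Polynomial.degree_add_le _ _).trans_lt (max_lt ?_ ?_)
    · rw [Polynomial.degree_mul, Polynomial.degree_mul, add_comm D.degree]
      exact WithBot.add_lt_add_left (by simpa [Polynomial.degree_eq_bot] using hD') hd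
    · rw [Polynomial.degree_mul, Polynomial.degree_mul]
      exact WithBot.add_lt_add_left (by simpa [Polynomial.degree_eq_bot] using hD) hd'

lemma HasExp.sum {ι : Type*} (s : Finset ι) (f : ι → PowerSeries ℚ) (a b : ι → ℚ)
    (h : ∀ i ∈ s, HasExp (f i) (a i) (b i)) :
    HasExp (∑ i ∈ s, f i) (∑ i ∈ s, a i) (∑ i ∈ s, b i) := by
  induction s using Finset.induction_on with
  | empty => simpa using HasExp.zero
  | insert i s hi ih =>
    rw [Finset.sum_insert hi, Finset.sum_insert hi, Finset.sum_insert hi]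
    exact (h i (by simp)).add (ih fun j hj => h j (by simp [hj]))

lemma HasExp.final {P f : PowerSeries ℚ} {a b : ℚ} (hP : P * f = 1) (h : HasExp f a b) :
    (a ≠ 0 →
      (∃ Q R : Polynomial ℚ, Q ≠ 0 ∧ R ≠ 0 ∧ (R : PowerSeries ℚ) * P = (Q : PowerSeries ℚ)) ∧
      ∀ Q R : Polynomial ℚ, Q ≠ 0 → R ≠ 0 → (R : PowerSeries ℚ) * P = (Q : PowerSeries ℚ) →
        Q.natDegree = R.natDegree ∧ R.leadingCoeff = a * Q.leadingCoeff) ∧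
    (a = 0 → b ≠ 0 →
      (∃ Q R : Polynomial ℚ, Q ≠ 0 ∧ R ≠ 0 ∧ (R : PowerSeries ℚ) * P = (Q : PowerSeries ℚ)) ∧
      ∀ Q R : Polynomial ℚ, Q ≠ 0 → R ≠ 0 → (R : PowerSeries ℚ) * P = (Q : PowerSeries ℚ) →
        Q.natDegree = R.natDegree + 1 ∧ R.leadingCoeff = b * Q.leadingCoeff) := by
  obtain ⟨D, N, hD, he, hd⟩ := h
  have hND : (N : PowerSeries ℚ) * P = (D : PowerSeries ℚ) := by
    rw [← he, mul_assoc, mul_comm f, hP, mul_one]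
  have hN : N ≠ 0 := by
    rintro rfl
    rw [Polynomial.coe_zero, zero_mul] at hND
    exact hD (by exact_mod_cast hND.symm)
  have cross : ∀ Q R : ℚ[X], (R : PowerSeries ℚ) * P = (Q : PowerSeries ℚ) → R * D = N * Q := by
    intro Q R h
    have : ((R * D : ℚ[X]) : PowerSeries ℚ) = ((N * Q : ℚ[X]) : PowerSeries ℚ) := by
      rw [Polynomial.coe_mul, Polynomial.coe_mul, ← hND, ← h]; ring
    exact_mod_cast this
  set E := Polynomial.X * N - (Polynomial.C a * Polynomial.X + Polynomial.C b) * D with hE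
  have hXN : Polynomial.X * N = (Polynomial.C a * Polynomial.X + Polynomial.C b) * D + E := by
    rw [hE]; ring
  have hDl : D.leadingCoeff ≠ 0 := by simpa using hD
  constructor
  · intro ha
    refine ⟨⟨D, N, hD, hN, hND⟩, fun Q R hQ hR h => ?_⟩
    have hc := cross Q R h
    have h1 : (Polynomial.C a * Polynomial.X + Polynomial.C b).degree = 1 :=
      Polynomial.degree_linear ha
    have h2 : E.degree < ((Polynomial.C a * Polynomial.X + Polynomial.C b) * D).degree := by
      rw [Polynomial.degree_mul, h1]
      refine hd.trans_le ?_
      calc D.degree = 0 + D.degree := by rw [zero_add]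
        _ ≤ 1 + D.degree := by gcongr; exact zero_le_one
    have h3 : (Polynomial.X * N).degree = 1 + D.degree := by
      rw [hXN, Polynomial.degree_add_eq_left_of_degree_lt h2, Polynomial.degree_mul, h1]
    have h4 : (Polynomial.X * N).leadingCoeff = a * D.leadingCoeff := by
      rw [hXN, Polynomial.leadingCoeff_add_of_degree_lt' h2, Polynomial.leadingCoeff_mul,
        Polynomial.leadingCoeff_linear ha]
    rw [Polynomial.leadingCoeff_mul, Polynomial.leadingCoeff_X, one_mul] at h4
    rw [Polynomial.degree_mul, Polynomial.degree_X, Polynomial.degree_eq_natDegree hN,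
      Polynomial.degree_eq_natDegree hD] at h3
    have h3' : N.natDegree = D.natDegree := by
      have : 1 + N.natDegree = 1 + D.natDegree := by exact_mod_cast h3
      omega
    have h5 := congrArg Polynomial.natDegree hc
    rw [Polynomial.natDegree_mul hR hD, Polynomial.natDegree_mul hN hQ] at h5
    have h6 := congrArg Polynomial.leadingCoeff hc
    rw [Polynomial.leadingCoeff_mul, Polynomial.leadingCoeff_mul, h4] at h6
    refine ⟨by omega, mul_right_cancel₀ hDl ?_⟩
    rw [h6]; ring
  · intro ha hb
    refine ⟨⟨D, N, hD, hN, hND⟩, fun Q R hQ hR h => ?_⟩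
    have hc := cross Q R h
    rw [ha, Polynomial.C_0, zero_mul, zero_add] at hXN
    have h2 : E.degree < (Polynomial.C b * D).degree := by
      rw [Polynomial.degree_C_mul hb]; exact hd
    have h3 : (Polynomial.X * N).degree = D.degree := by
      rw [hXN, Polynomial.degree_add_eq_left_of_degree_lt h2, Polynomial.degree_C_mul hb]
    have h4 : (Polynomial.X * N).leadingCoeff = b * D.leadingCoeff := by
      rw [hXN, Polynomial.leadingCoeff_add_of_degree_lt' h2, Polynomial.leadingCoeff_mul,
        Polynomial.leadingCoeff_C]
    rw [Polynomial.leadingCoeff_mul, Polynomial.leadingCoeff_X, one_mul] at h4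
    rw [Polynomial.degree_mul, Polynomial.degree_X, Polynomial.degree_eq_natDegree hN,
      Polynomial.degree_eq_natDegree hD] at h3
    have h3' : 1 + N.natDegree = D.natDegree := by exact_mod_cast h3
    have h5 := congrArg Polynomial.natDegree hc
    rw [Polynomial.natDegree_mul hR hD, Polynomial.natDegree_mul hN hQ] at h5
    have h6 := congrArg Polynomial.leadingCoeff hc
    rw [Polynomial.leadingCoeff_mul, Polynomial.leadingCoeff_mul, h4] at h6
    refine ⟨by omega, mul_right_cancel₀ hDl ?_⟩
    rw [h6]; ring

end Expansion

section Main
variable {n : ℕ} (M : CoxeterMatrix (Fin n))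

lemma Pser_const (I : Finset (Fin n)) : PowerSeries.constantCoeff (Pser M I) = 1 := by
  rw [← PowerSeries.coeff_zero_eq_constantCoeff_apply, Pser, PowerSeries.coeff_mk]
  have : (lev M 0).filter (fun w => w ∈ coxParabolic M I) = {1} := by
    ext w
    simp only [Finset.mem_filter, mem_lev, CoxeterSystem.length_eq_zero_iff, Finset.mem_singleton]
    exact ⟨fun h => h.1, fun h => ⟨h, h ▸ one_mem _⟩⟩
  rw [this]; simp

lemma Pser_mul_inv (I : Finset (Fin n)) : Pser M I * (Pser M I)⁻¹ = 1 :=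
  PowerSeries.mul_inv_cancel _ (by rw [Pser_const]; exact one_ne_zero)

lemma Pser_ne (I : Finset (Fin n)) : Pser M I ≠ 0 := by
  intro h
  have := Pser_const M I
  rw [h] at this
  simp at this

lemma inv_rec {I : Finset (Fin n)} (hI : Infinite (coxParabolic M I)) :
    (Pser M I)⁻¹ = PowerSeries.C ((-1 : ℚ) ^ (I.card + 1)) *
      ∑ J ∈ I.ssubsets, PowerSeries.C ((-1 : ℚ) ^ J.card) * (Pser M J)⁻¹ := by
  have h1 := sum_Qser M hI
  have h2 : ∑ J ∈ I.powerset, PowerSeries.C ((-1 : ℚ) ^ J.card) * (Pser M J)⁻¹ = 0 := by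
    have h3 : Pser M I * ∑ J ∈ I.powerset, PowerSeries.C ((-1 : ℚ) ^ J.card) * (Pser M J)⁻¹
        = 0 := by
      rw [← h1, Finset.mul_sum]
      refine Finset.sum_congr rfl fun J hJ => ?_
      have e1 : Pser M I * (Pser M J)⁻¹ = Qser M I J := by
        rw [Pser_eq M (Finset.mem_powerset.mp hJ), mul_assoc, Pser_mul_inv, mul_one]
      rw [← e1]
      simp only [map_pow, map_neg, map_one]
      ring
    exact (mul_eq_zero.mp h3).resolve_left (Pser_ne M I)
  rw [← Finset.insert_erase (Finset.mem_powerset_self I), Finset.sum_insert (by simp)] at h2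
  change _ + ∑ J ∈ I.ssubsets, _ = 0 at h2
  have h3 := eq_neg_of_add_eq_zero_right h2
  have hC : ∀ m : ℕ, PowerSeries.C ((-1 : ℚ) ^ m) = (-1 : PowerSeries ℚ) ^ m := by
    intro m; rw [map_pow, map_neg, map_one]
  rw [h3, hC, hC, pow_succ]
  have : ((-1 : PowerSeries ℚ) ^ I.card) * (-1) ^ I.card = 1 := by
    rw [← mul_pow]; simp
  linear_combination (-(Pser M I)⁻¹) * this

lemma finite_poly {I : Finset (Fin n)} (hI : Finite (coxParabolic M I)) :
    ∃ p : Polynomial ℚ, (p : PowerSeries ℚ) = Pser M I := by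
  have hf : (coxParabolic M I : Set M.Group).Finite := hI
  obtain ⟨B, hB⟩ := (hf.image M.toCoxeterSystem.length).bddAbove
  refine ⟨PowerSeries.trunc (B + 1) (Pser M I), ?_⟩
  ext k
  rw [Polynomial.coeff_coe, PowerSeries.coeff_trunc]
  split_ifs with h
  · rfl
  · rw [Pser, PowerSeries.coeff_mk]
    symm
    rw [Nat.cast_eq_zero, Finset.card_eq_zero, Finset.filter_eq_empty_iff]
    intro w hw hm
    rw [mem_lev] at hw
    have := hB ⟨w, hm, hw⟩
    omega

lemma par_single (i : Fin n) (w : M.Group) :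
    w ∈ coxParabolic M {i} ↔ w = 1 ∨ w = M.toCoxeterSystem.simple i := by
  unfold coxParabolic
  rw [Finset.coe_singleton, Set.image_singleton, Subgroup.mem_closure_singleton]
  constructor
  · rintro ⟨k, rfl⟩
    have h2 : M.toCoxeterSystem.simple i ^ (2 : ℤ) = 1 := by
      exact_mod_cast M.toCoxeterSystem.simple_sq i
    rcases Int.even_or_odd' k with ⟨m, rfl | rfl⟩
    · left; rw [zpow_mul, h2, one_zpow]
    · right; rw [zpow_add, zpow_mul, h2, one_zpow, one_mul, zpow_one]
  · rintro (rfl | rfl)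
    · exact ⟨0, by simp⟩
    · exact ⟨1, by simp⟩

lemma finite_single (i : Fin n) : Finite (coxParabolic M {i}) := by
  have : (coxParabolic M {i} : Set M.Group).Finite := by
    refine (Set.toFinite {1, M.toCoxeterSystem.simple i}).subset ?_
    intro w hw
    exact (par_single M i w).mp hw
  exact this

lemma Pser_single (i : Fin n) : Pser M {i} = 1 + PowerSeries.X := by
  ext k
  rw [Pser, PowerSeries.coeff_mk, map_add, PowerSeries.coeff_one, PowerSeries.coeff_X]
  have hne : ∀ w : M.Group, w = M.toCoxeterSystem.simple i → M.toCoxeterSystem.length w = 1 := by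
    rintro w rfl; exact M.toCoxeterSystem.length_simple i
  have : (lev M k).filter (fun w => w ∈ coxParabolic M {i}) =
      if k = 0 then {1} else if k = 1 then {M.toCoxeterSystem.simple i} else ∅ := by
    ext w
    simp only [Finset.mem_filter, mem_lev, par_single]
    split_ifs with h h
    · subst h
      rw [CoxeterSystem.length_eq_zero_iff, Finset.mem_singleton]; tauto
    · subst h
      rw [Finset.mem_singleton]
      constructor
      · rintro ⟨h1, rfl | h2⟩
        · simp at h1
        · exact h2
      · intro h2; exact ⟨hne w h2, Or.inr h2⟩
    · simp only [Finset.notMem_empty, iff_false]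
      rintro ⟨h1, rfl | h2⟩
      · simp at h1; omega
      · have := hne w h2; omega
  rw [this]
  split_ifs <;> simp_all

lemma Pser_empty : Pser M ∅ = 1 := by
  ext k
  rw [Pser, PowerSeries.coeff_mk, PowerSeries.coeff_one]
  have h0 : ∀ w, w ∈ coxParabolic M ∅ ↔ w = 1 := by
    intro w; simp [coxParabolic]
  have : (lev M k).filter (fun w => w ∈ coxParabolic M ∅) = if k = 0 then {1} else ∅ := by
    ext w
    simp only [Finset.mem_filter, mem_lev, h0]
    split_ifs with h
    · subst h
      rw [CoxeterSystem.length_eq_zero_iff, Finset.mem_singleton]; tauto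
    · simp only [Finset.notMem_empty, iff_false]
      rintro ⟨h1, rfl⟩
      simp at h1; omega
  rw [this]
  split_ifs <;> simp

lemma exp_finite (hs : ∀ i j, i ≠ j → M.toCoxeterSystem.simple i ≠ M.toCoxeterSystem.simple j)
    {I : Finset (Fin n)} (hI : Finite (coxParabolic M I)) :
    HasExp (Pser M I)⁻¹ (if I = ∅ then 1 else 0) (if I.card = 1 then 1 else 0) := by
  rcases Nat.lt_or_ge 1 I.card with h | h
  · rw [if_neg (by rintro rfl; simp at h), if_neg (by omega)]
    obtain ⟨p, hp⟩ := finite_poly M hI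
    have hc : p.coeff 2 ≠ 0 := by
      rw [← Polynomial.coeff_coe, hp, Pser, PowerSeries.coeff_mk, Nat.cast_ne_zero,
        Finset.card_ne_zero]
      obtain ⟨i, hi, j, hj, hij⟩ := Finset.one_lt_card.mp h
      refine ⟨M.toCoxeterSystem.simple i * M.toCoxeterSystem.simple j, ?_⟩
      rw [Finset.mem_filter, mem_lev]
      constructor
      · rcases M.toCoxeterSystem.length_mul_simple (M.toCoxeterSystem.simple i) j with h1 | h1
        · rw [h1, CoxeterSystem.length_simple]
        · exfalso
          rw [CoxeterSystem.length_simple] at h1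
          have h2 : M.toCoxeterSystem.length
            (M.toCoxeterSystem.simple i * M.toCoxeterSystem.simple j) = 0 := by omega
          rw [CoxeterSystem.length_eq_zero_iff, mul_eq_one_iff_eq_inv,
            CoxeterSystem.inv_simple] at h2
          exact hs i j hij h2
      · have := word_mem M [i, j] (I := I) (by simp [hi, hj])
        rwa [CoxeterSystem.wordProd_cons, CoxeterSystem.wordProd_singleton] at this
    refine ⟨p, 1, ?_, ?_, ?_⟩
    · rintro rfl; simp at hc
    · rw [hp, Pser_mul_inv, Polynomial.coe_one]
    · simp only [Polynomial.C_0, zero_mul, add_zero, sub_zero, mul_one, Polynomial.degree_X]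
      have : ((2 : ℕ) : WithBot ℕ) ≤ p.degree := Polynomial.le_degree_of_ne_zero hc
      exact lt_of_lt_of_le (by exact_mod_cast Nat.one_lt_two) this
  · rcases Nat.lt_or_ge I.card 1 with h0 | h0
    · have : I = ∅ := by rw [← Finset.card_eq_zero]; omega
      subst this
      rw [Pser_empty]
      exact ⟨1, 1, one_ne_zero, by simp, by simp⟩
    · have h1 : I.card = 1 := by omega
      rw [if_neg (by rintro rfl; simp at h1), if_pos h1]
      obtain ⟨i, rfl⟩ := Finset.card_eq_one.mp h1
      have hdeg : (1 + Polynomial.X : Polynomial ℚ).degree = 1 := by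
        rw [add_comm, ← Polynomial.C_1]; exact Polynomial.degree_X_add_C 1
      refine ⟨1 + Polynomial.X, 1, ?_, ?_, ?_⟩
      · intro h; rw [h] at hdeg; simp at hdeg
      · have := Pser_mul_inv M {i}
        rw [Pser_single] at this ⊢
        simpa using this
      · rw [hdeg]
        have : (Polynomial.X * 1 - (Polynomial.C 0 * Polynomial.X + Polynomial.C 1) *
          (1 + Polynomial.X) : Polynomial ℚ) = Polynomial.C (-1) := by
          simp
        rw [this]
        exact lt_of_le_of_lt Polynomial.degree_C_le (by simp)

lemma exp_all (hs : ∀ i j, i ≠ j → M.toCoxeterSystem.simple i ≠ M.toCoxeterSystem.simple j)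
    (I : Finset (Fin n)) :
    HasExp (Pser M I)⁻¹
      ((-1) ^ (I.card + 1) * (U (infI M) (infI M) I : ℚ) + if I = ∅ then 1 else 0)
      ((-1) ^ (I.card + 1) * (U (infI M) oneI I : ℚ)) := by
  induction I using Finset.strongInduction with
  | H I ih =>
    have hl0 := not_infI_empty M
    have hl1 : ¬ oneI (∅ : Finset (Fin n)) := by simp [oneI]
    rw [U_rec _ _ hl0, U_rec _ _ hl1]
    by_cases hI : infI M I
    · have hne : I ≠ ∅ := by rintro rfl; exact hl0 hI
      have h1 : ¬ oneI I := by
        intro h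
        obtain ⟨i, rfl⟩ := Finset.card_eq_one.mp h
        exact (not_infinite_iff_finite.mpr (finite_single M i)) hI
      rw [inv_rec M hI, if_pos hI, if_pos hI, if_neg h1, if_neg hne]
      have key := (HasExp.sum I.ssubsets _ _ _ (fun J hJ =>
        (ih J (Finset.mem_ssubsets.mp hJ)).smul ((-1 : ℚ) ^ J.card))).smul
          ((-1 : ℚ) ^ (I.card + 1))
      have hsq : ∀ J : Finset (Fin n), ((-1 : ℚ) ^ J.card) * (-1) ^ J.card = 1 := by
        intro J; rw [← mul_pow]; simp
      convert key using 1
      · push_cast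
        rw [add_zero]
        congr 1
        have : ∀ J ∈ I.ssubsets, (-1 : ℚ) ^ J.card *
            ((-1) ^ (J.card + 1) * (U (infI M) (infI M) J : ℚ) + if J = ∅ then 1 else 0) =
            (if J = ∅ then 1 else 0) - (U (infI M) (infI M) J : ℚ) := by
          intro J _
          have := hsq J
          split_ifs with hJ
          · subst hJ; simp; ring
          · rw [pow_succ]; linear_combination (-(U (infI M) (infI M) J : ℚ)) * this
        rw [Finset.sum_congr rfl this, Finset.sum_sub_distrib, Finset.sum_ite_eq', if_pos]
        exact Finset.mem_ssubsets.mpr (Finset.empty_ssubset.mpr (Finset.nonempty_iff_ne_empty.mpr hne))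
      · push_cast
        try rw [if_pos hI]
        rw [zero_sub]
        congr 1
        rw [← Finset.sum_neg_distrib]
        refine Finset.sum_congr rfl fun J _ => ?_
        rw [pow_succ]; linear_combination ((U (infI M) oneI J : ℚ)) * hsq J
    · have hf : Finite (coxParabolic M I) := not_infinite_iff_finite.mp hI
      rw [if_neg hI, if_neg hI, if_neg hI]
      have := exp_finite M hs hf
      convert this using 1
      · simp
      · by_cases h : I.card = 1
        · simp [oneI, h]
        · simp [oneI, h]

lemma par_univ : coxParabolic M Finset.univ = ⊤ := by
  unfold coxParabolic
  rw [Finset.coe_univ, Set.image_univ, CoxeterSystem.subgroup_closure_range_simple]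

lemma Pser_univ : Pser M Finset.univ = coxPoincareQ M := by
  ext k
  rw [Pser, coxPoincareQ, PowerSeries.coeff_mk, PowerSeries.coeff_mk, par_univ]
  congr 1
  rw [Finset.filter_true_of_mem (fun _ _ => Subgroup.mem_top _), lev,
    ← Set.ncard_eq_toFinset_card _ (finite_level M k)]
  rfl

end Main

end CoxAux

/-- for a generalized Cartan matrix `A` with infinite Weyl group and
connected Coxeter graph: (1) if `K₀(A) ≠ 0` then `deg P(A) = 0` and in any
representation `R·P(A) = Q` (with `Q, R` nonzero polynomials) the leading coefficient
of `R` is `K₀(A)` times that of `Q`; (2) if `K₀(A) = 0` and `K₁(A) ≠ 0` then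
`deg P(A) = 1` and the leading coefficient of `R` is `K₁(A)` times that of `Q`. -/
theorem poincare_deg_and_leading_coeff {n : ℕ} (A : Matrix (Fin n) (Fin n) ℤ)
    (hA : IsGCM A) (hinf : Infinite (gcmCoxeter A).Group)
    (hconn : (coxeterGraph (gcmCoxeter A)).Connected) :
    (K0 (gcmCoxeter A) ≠ 0 →
      (∃ Q R : Polynomial ℚ, Q ≠ 0 ∧ R ≠ 0 ∧
          (R : PowerSeries ℚ) * coxPoincareQ (gcmCoxeter A) = (Q : PowerSeries ℚ)) ∧
      ∀ Q R : Polynomial ℚ, Q ≠ 0 → R ≠ 0 →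
        (R : PowerSeries ℚ) * coxPoincareQ (gcmCoxeter A) = (Q : PowerSeries ℚ) →
        Q.natDegree = R.natDegree ∧
        R.leadingCoeff = (K0 (gcmCoxeter A) : ℚ) * Q.leadingCoeff) ∧
    (K0 (gcmCoxeter A) = 0 → K1 (gcmCoxeter A) ≠ 0 →
      (∃ Q R : Polynomial ℚ, Q ≠ 0 ∧ R ≠ 0 ∧
          (R : PowerSeries ℚ) * coxPoincareQ (gcmCoxeter A) = (Q : PowerSeries ℚ)) ∧
      ∀ Q R : Polynomial ℚ, Q ≠ 0 → R ≠ 0 →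
        (R : PowerSeries ℚ) * coxPoincareQ (gcmCoxeter A) = (Q : PowerSeries ℚ) →
        Q.natDegree = R.natDegree + 1 ∧
        R.leadingCoeff = (K1 (gcmCoxeter A) : ℚ) * Q.leadingCoeff) := by
  have hs := fun i j h => CoxAux.simple_ne A hA (i := i) (j := j) h
  have hexp := CoxAux.exp_all (gcmCoxeter A) hs Finset.univ
  have hinf' : CoxAux.infI (gcmCoxeter A) Finset.univ := by
    unfold CoxAux.infI
    rw [CoxAux.par_univ]
    exact Infinite.of_surjective (fun x : (⊤ : Subgroup (gcmCoxeter A).Group) => (x : (gcmCoxeter A).Group))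
      (fun x => ⟨⟨x, Subgroup.mem_top x⟩, rfl⟩)
  have hne : (Finset.univ : Finset (Fin n)) ≠ ∅ := by
    intro h
    rw [h] at hinf'
    exact CoxAux.not_infI_empty _ hinf'
  have hP := CoxAux.Pser_mul_inv (gcmCoxeter A) Finset.univ
  have e0 : ((K0 (gcmCoxeter A) : ℤ) : ℚ) = (-1) ^ ((Finset.univ : Finset (Fin n)).card + 1) *
      (CoxAux.U (CoxAux.infI (gcmCoxeter A)) (CoxAux.infI (gcmCoxeter A)) Finset.univ : ℚ) := by
    rw [CoxAux.K0_eq]; simp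
  have e1 : ((K1 (gcmCoxeter A) : ℤ) : ℚ) = (-1) ^ ((Finset.univ : Finset (Fin n)).card + 1) *
      (CoxAux.U (CoxAux.infI (gcmCoxeter A)) CoxAux.oneI Finset.univ : ℚ) := by
    rw [CoxAux.K1_eq]; simp
  rw [if_neg hne, add_zero, ← e0, ← e1] at hexp
  have hfin := hexp.final hP
  rw [CoxAux.Pser_univ] at hfin
  refine ⟨fun h => hfin.1 (by exact_mod_cast h), fun h h' => hfin.2 (by exact_mod_cast h) ?_⟩
  exact_mod_cast h'
end
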